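/- Let C ⊂ ℝ³ be a convex body and r₀ ∈ ∂C a ridge point whose tangent cone is the dihedral angle {r : (r − r₀, e₁) ≤ 0, (r − r₀, e₂) ≤ 0}, and let e = λ₁e₁ + λ₂e₂ with λ₁ > 0, λ₂ > 0, |e| = 1. Then the set of partial weak limits of the family of normalized surface measures ν_t as t → 0⁺ is nonempty, and every partial weak limit ν_* is supported on a closed subset of the arc Γ = {μ₁e₁ + μ₂e₂ : |μ₁e₁ + μ₂e₂| = 1, μ₁ ≥ 0, μ₂ ≥ 0} ⊂ S² that contains both e₁ and e₂. -/

import Mathlib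

open MeasureTheory Set Filter Topology
open scoped RealInnerProductSpace ENNReal

noncomputable section

attribute [local instance] Classical.propDecidable

abbrev E3 := EuclideanSpace ℝ (Fin 3)

/-- A convex body: a compact convex set with nonempty interior. -/
def IsConvexBody (C : Set E3) : Prop :=
  IsCompact C ∧ Convex ℝ C ∧ (interior C).Nonempty

/-- The tangent cone to a convex set `C` at the point `r₀`: the closure of the set of
rays from `r₀` through points of `C`, translated to the origin. -/
def tanCone (C : Set E3) (r₀ : E3) : Set E3 :=
  closure {v : E3 | ∃ c : ℝ, ∃ r ∈ C, 0 ≤ c ∧ v = c • (r - r₀)}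

/-- The dihedral angle `{v : ⟪v,e₁⟫ ≤ 0, ⟪v,e₂⟫ ≤ 0}` (as a cone of displacements). -/
def dihedral (e₁ e₂ : E3) : Set E3 := {v : E3 | ⟪v, e₁⟫ ≤ 0 ∧ ⟪v, e₂⟫ ≤ 0}

/-- `n` is an outward unit normal of `C` at `r`. -/
def IsOutwardNormalAt (C : Set E3) (r n : E3) : Prop :=
  ‖n‖ = 1 ∧ ∀ x ∈ C, ⟪x - r, n⟫ ≤ 0

/-- `r` is a regular boundary point: the outward unit normal exists and is unique. -/
def IsRegularPt (C : Set E3) (r : E3) : Prop :=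
  ∃! n : E3, IsOutwardNormalAt C r n

/-- The (Gauss) normal map of `C`, sending a boundary point to an outward unit normal
(the unique one at regular points), and junk value `0` elsewhere. -/
def normalMap (C : Set E3) (r : E3) : E3 :=
  if h : ∃ n : E3, IsOutwardNormalAt C r n then h.choose else 0

/-- `B_t = C ∩ {r : ⟪r - r₀, e⟫ = -t}`. -/
def Bset (C : Set E3) (r₀ e : E3) (t : ℝ) : Set E3 :=
  C ∩ {r : E3 | ⟪r - r₀, e⟫ = -t}

/-- `S_t = ∂C ∩ {r : ⟪r - r₀, e⟫ ≥ -t}`. -/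
def Sset (C : Set E3) (r₀ e : E3) (t : ℝ) : Set E3 :=
  frontier C ∩ {r : E3 | ⟪r - r₀, e⟫ ≥ -t}

/-- The normalized surface measure `ν_t` induced by `S_t`: the pushforward under the
normal map of the 2-dimensional Hausdorff measure restricted to the regular points of
`S_t`, normalized by the area of `B_t`. -/
def nuT (C : Set E3) (r₀ e : E3) (t : ℝ) : Measure E3 :=
  (μH[2] (Bset C r₀ e t))⁻¹ •
    Measure.map (normalMap C) (μH[2].restrict (Sset C r₀ e t ∩ {r : E3 | IsRegularPt C r}))

/-- The arc `Γ = {μ₁e₁ + μ₂e₂ : |μ₁e₁ + μ₂e₂| = 1, μ₁ ≥ 0, μ₂ ≥ 0}`. -/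
def arcGamma (e₁ e₂ : E3) : Set E3 :=
  {v : E3 | ∃ m₁ m₂ : ℝ, 0 ≤ m₁ ∧ 0 ≤ m₂ ∧ v = m₁ • e₁ + m₂ • e₂ ∧ ‖v‖ = 1}

/-- Weak convergence of the family `ν t` to `ν₀` as `t → 0⁺`. -/
def WeaklyTendsto (ν : ℝ → Measure E3) (ν₀ : Measure E3) : Prop :=
  ∀ f : BoundedContinuousFunction E3 ℝ,
    Tendsto (fun t => ∫ x, f x ∂(ν t)) (𝓝[>] (0 : ℝ)) (𝓝 (∫ x, f x ∂ν₀))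

/-- `ν₀` is a partial weak limit of the family `ν t` as `t → 0⁺`. -/
def IsPartialWeakLimit (ν : ℝ → Measure E3) (ν₀ : Measure E3) : Prop :=
  ∃ ts : ℕ → ℝ, (∀ i, 0 < ts i) ∧ Tendsto ts atTop (𝓝 (0 : ℝ)) ∧
    ∀ f : BoundedContinuousFunction E3 ℝ,
      Tendsto (fun i => ∫ x, f x ∂(ν (ts i))) atTop (𝓝 (∫ x, f x ∂ν₀))

/-- The support of a measure: points all of whose open neighborhoods have positive measure. -/
def msupport (ν : Measure E3) : Set E3 :=
  {x : E3 | ∀ U : Set E3, IsOpen U → x ∈ U → 0 < ν U}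


theorem haus_antilip (s : Set E3) (f : E3 → E3) (K : NNReal)
    (h : ∀ x ∈ s, ∀ y ∈ s, dist x y ≤ K * dist (f x) (f y)) :
    μH[2] s ≤ (K : ℝ≥0∞) ^ (2:ℝ) * μH[2] (f '' s) := by
  have hinj : InjOn f s := by
    intro x hx y hy hxy
    have := h x hx y hy
    rw [hxy, dist_self, mul_zero] at this
    exact dist_le_zero.1 this
  have hL : LipschitzOnWith K (Function.invFunOn f s) (f '' s) := by
    apply LipschitzOnWith.of_dist_le_mul
    rintro _ ⟨x, hx, rfl⟩ _ ⟨y, hy, rfl⟩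
    rw [hinj.leftInvOn_invFunOn hx, hinj.leftInvOn_invFunOn hy]
    exact h x hx y hy
  have := hL.hausdorffMeasure_image_le (d := 2) (by norm_num)
  rwa [hinj.leftInvOn_invFunOn.image_image] at this

theorem finrank_perp (u : E3) (hu : ‖u‖ = 1) : Module.finrank ℝ (ℝ ∙ u)ᗮ = 2 := by
  have : Fact (Module.finrank ℝ E3 = 2 + 1) := ⟨by simp⟩
  exact Submodule.finrank_orthogonal_span_singleton (by intro h; simp [h] at hu)

theorem haus_haar (u : E3) (hu : ‖u‖ = 1) :
    (μH[2] : Measure (ℝ ∙ u)ᗮ).IsAddHaarMeasure := by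
  have := isAddHaarMeasure_hausdorffMeasure (E := (ℝ ∙ u)ᗮ)
  rw [finrank_perp u hu] at this
  exact_mod_cast this

theorem mem_perp (u x : E3) : x ∈ (ℝ ∙ u)ᗮ ↔ ⟪x, u⟫ = 0 := by
  rw [Submodule.mem_orthogonal_singleton_iff_inner_left]

theorem disc_eq (u : E3) (R : ℝ) :
    {x : E3 | ⟪x, u⟫ = 0 ∧ ‖x‖ ≤ R} =
      ((↑) : (ℝ ∙ u)ᗮ → E3) '' (Metric.closedBall 0 R) := by
  ext x
  constructor
  · rintro ⟨h1, h2⟩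
    exact ⟨⟨x, (mem_perp u x).2 h1⟩, by simpa using h2, rfl⟩
  · rintro ⟨y, hy, rfl⟩
    exact ⟨(mem_perp u _).1 y.2, by simpa using hy⟩

theorem disc_lt_top (u : E3) (hu : ‖u‖ = 1) (R : ℝ) :
    μH[2] {x : E3 | ⟪x, u⟫ = 0 ∧ ‖x‖ ≤ R} < ⊤ := by
  have := haus_haar u hu
  rw [disc_eq, (isometry_subtype_coe).hausdorffMeasure_image (Or.inl (by norm_num))]
  exact (isCompact_closedBall _ _).measure_lt_top

theorem haus_smul (c : ℝ) (hc : 0 < c) (s : Set E3) :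
    μH[2] ((fun x : E3 => c • x) '' s) = ENNReal.ofReal (c ^ 2) * μH[2] s := by
  rw [Set.image_smul, Measure.hausdorffMeasure_smul₀ (by norm_num) hc.ne']
  rw [ENNReal.smul_def, smul_eq_mul]
  congr 1
  rw [← ENNReal.ofReal_coe_nnreal]
  congr 1
  simp

theorem haus_vadd (a : E3) (s : Set E3) :
    μH[2] ((fun x : E3 => a + x) '' s) = μH[2] s :=
  (IsometryEquiv.addLeft a).hausdorffMeasure_image 2 s

theorem haus_homothety (r₀ : E3) (c : ℝ) (hc : 0 < c) (s : Set E3) :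
    μH[2] ((fun x : E3 => r₀ + c • (x - r₀)) '' s) = ENNReal.ofReal (c ^ 2) * μH[2] s := by
  have : (fun x : E3 => r₀ + c • (x - r₀)) '' s =
    (fun x => r₀ + x) '' ((fun x : E3 => c • x) '' ((fun x => -r₀ + x) '' s)) := by
    simp only [Set.image_image]
    congr 1; ext1 x; congr 2; abel
  rw [this, haus_vadd, haus_smul c hc, haus_vadd]

theorem disc_scale (u : E3) (R : ℝ) (hR : 0 < R) :
    μH[2] {x : E3 | ⟪x, u⟫ = 0 ∧ ‖x‖ ≤ R} =
      ENNReal.ofReal (R ^ 2) * μH[2] {x : E3 | ⟪x, u⟫ = 0 ∧ ‖x‖ ≤ 1} := by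
  rw [← haus_smul R hR]
  congr 1
  ext x
  constructor
  · rintro ⟨h1, h2⟩
    refine ⟨R⁻¹ • x, ⟨by simp [inner_smul_left, h1], ?_⟩, by simp [smul_smul, hR.ne']⟩
    rw [norm_smul, Real.norm_of_nonneg (by positivity)]
    rw [inv_mul_le_iff₀ hR]; simpa using h2
  · rintro ⟨y, ⟨h1, h2⟩, rfl⟩
    refine ⟨by simp [inner_smul_left, h1], ?_⟩
    simp only [norm_smul, Real.norm_of_nonneg hR.le]
    nlinarith

/-! ### measurability -/

theorem isCompact_normals (C : Set E3) (hC : IsCompact C) (A : Set E3) (hA : IsClosed A) :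
    IsCompact {r : E3 | r ∈ frontier C ∧ ∃ n ∈ A, IsOutwardNormalAt C r n} := by
  have h1 : IsCompact (frontier C) :=
    hC.of_isClosed_subset isClosed_frontier hC.isClosed.frontier_subset
  have h2 : IsCompact ((frontier C ×ˢ Metric.sphere (0:E3) 1) ∩
      ({q : E3 × E3 | q.2 ∈ A} ∩ {q : E3 × E3 | ∀ x ∈ C, ⟪x - q.1, q.2⟫ ≤ 0})) := by
    apply (h1.prod (isCompact_sphere _ _)).inter_right
    apply (hA.preimage continuous_snd).inter
    simp only [Set.ofPred_forall]
    refine isClosed_biInter fun x _ => isClosed_le (by fun_prop) (by fun_prop)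
  convert h2.image continuous_fst using 1
  ext r
  simp only [mem_image, Prod.exists, mem_inter_iff, mem_prod, mem_ofPred_eq,
    IsOutwardNormalAt, mem_sphere_zero_iff_norm]
  constructor
  · rintro ⟨h, n, hn, h3, h4⟩
    exact ⟨r, n, ⟨⟨h, h3⟩, hn, h4⟩, rfl⟩
  · rintro ⟨a, n, ⟨⟨h, h3⟩, hn, h4⟩, rfl⟩
    exact ⟨h, n, hn, h3, h4⟩

theorem isCompact_two_normals (C : Set E3) (hC : IsCompact C) (ε : ℝ) :
    IsCompact {r : E3 | r ∈ frontier C ∧ ∃ n m, IsOutwardNormalAt C r n ∧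
      IsOutwardNormalAt C r m ∧ ε ≤ ‖n - m‖} := by
  have h1 : IsCompact (frontier C) :=
    hC.of_isClosed_subset isClosed_frontier hC.isClosed.frontier_subset
  have h2 : IsCompact ((frontier C ×ˢ (Metric.sphere (0:E3) 1 ×ˢ Metric.sphere (0:E3) 1)) ∩
      ({q : E3 × E3 × E3 | ε ≤ ‖q.2.1 - q.2.2‖} ∩ ({q | ∀ x ∈ C, ⟪x - q.1, q.2.1⟫ ≤ 0} ∩
        {q | ∀ x ∈ C, ⟪x - q.1, q.2.2⟫ ≤ 0}))) := by
    apply (h1.prod ((isCompact_sphere _ _).prod (isCompact_sphere _ _))).inter_right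
    apply (isClosed_le (by fun_prop) (by fun_prop)).inter
    simp only [Set.ofPred_forall]
    refine (isClosed_biInter fun x _ => isClosed_le (by fun_prop) (by fun_prop)).inter
      (isClosed_biInter fun x _ => isClosed_le (by fun_prop) (by fun_prop))
  convert h2.image continuous_fst using 1
  ext r
  simp only [mem_image, Prod.exists, mem_inter_iff, mem_prod, mem_ofPred_eq,
    IsOutwardNormalAt, mem_sphere_zero_iff_norm]
  constructor
  · rintro ⟨h, n, m, ⟨h3, h4⟩, ⟨h5, h6⟩, h7⟩
    exact ⟨r, n, m, ⟨⟨h, h3, h5⟩, h7, h4, h6⟩, rfl⟩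
  · rintro ⟨a, n, m, ⟨⟨h, h3, h5⟩, h7, h4, h6⟩, rfl⟩
    exact ⟨h, n, m, ⟨h3, h4⟩, ⟨h5, h6⟩, h7⟩

theorem measurableSet_reg (C : Set E3) (hC : IsCompact C) :
    MeasurableSet (frontier C ∩ {r : E3 | IsRegularPt C r}) := by
  have : frontier C ∩ {r : E3 | IsRegularPt C r} =
      {r : E3 | r ∈ frontier C ∧ ∃ n ∈ (univ : Set E3), IsOutwardNormalAt C r n} \
      ⋃ k : ℕ, {r : E3 | r ∈ frontier C ∧ ∃ n m, IsOutwardNormalAt C r n ∧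
      IsOutwardNormalAt C r m ∧ 1 / ((k:ℝ) + 1) ≤ ‖n - m‖} := by
    ext r
    simp only [mem_inter_iff, mem_ofPred_eq, Set.mem_sdiff, mem_iUnion, mem_univ, true_and]
    constructor
    · rintro ⟨h, n, hn, hu⟩
      refine ⟨⟨h, n, hn⟩, ?_⟩
      rintro ⟨k, -, a, b, ha, hb, hab⟩
      rw [hu a ha, hu b hb, sub_self, norm_zero] at hab
      have : (0:ℝ) < 1 / ((k:ℝ)+1) := by positivity
      linarith
    · rintro ⟨⟨h, n, hn⟩, h2⟩
      refine ⟨h, n, hn, fun m hm => ?_⟩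
      by_contra hne
      apply h2
      obtain ⟨k, hk⟩ := exists_nat_one_div_lt (norm_pos_iff.2 (sub_ne_zero.2 hne))
      exact ⟨k, h, m, n, hm, hn, hk.le⟩
  rw [this]
  refine (isCompact_normals C hC univ isClosed_univ).measurableSet.diff
    (MeasurableSet.iUnion fun k => (isCompact_two_normals C hC _).measurableSet)

theorem measurableSet_Sreg (C : Set E3) (hC : IsCompact C) (r₀ e : E3) (t : ℝ) :
    MeasurableSet (Sset C r₀ e t ∩ {r : E3 | IsRegularPt C r}) := by
  have : Sset C r₀ e t ∩ {r : E3 | IsRegularPt C r} =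
    (frontier C ∩ {r : E3 | IsRegularPt C r}) ∩ {r : E3 | ⟪r - r₀, e⟫ ≥ -t} := by
    unfold Sset; ext; simp only [mem_inter_iff, mem_ofPred_eq]; tauto
  rw [this]
  refine (measurableSet_reg C hC).inter (IsClosed.measurableSet ?_)
  exact isClosed_le (by fun_prop) (by fun_prop)

theorem normalMap_spec (C : Set E3) (r : E3) (h : IsRegularPt C r) :
    IsOutwardNormalAt C r (normalMap C r) := by
  unfold normalMap
  rw [dif_pos h.exists]
  exact h.exists.choose_spec

theorem aemeasurable_normalMap (C : Set E3) (hC : IsCompact C) (r₀ e : E3) (t : ℝ) :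
    AEMeasurable (normalMap C)
      ((μH[2] : Measure E3).restrict (Sset C r₀ e t ∩ {r : E3 | IsRegularPt C r})) := by
  set R := Sset C r₀ e t ∩ {r : E3 | IsRegularPt C r} with hR
  have hm : MeasurableSet R := measurableSet_Sreg C hC r₀ e t
  rw [aemeasurable_restrict_iff_comap_subtype hm]
  apply Measurable.aemeasurable
  apply measurable_of_isClosed
  intro A hA
  have : (fun x : R => normalMap C x) ⁻¹' A =
      ((↑) : R → E3) ⁻¹' {r : E3 | r ∈ frontier C ∧ ∃ n ∈ A, IsOutwardNormalAt C r n} := by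
    ext ⟨r, hr⟩
    simp only [mem_preimage, mem_ofPred_eq]
    have hreg : IsRegularPt C r := hr.2
    constructor
    · intro h
      exact ⟨hr.1.1, _, h, normalMap_spec C r hreg⟩
    · rintro ⟨-, n, hn, h⟩
      rwa [hreg.unique (normalMap_spec C r hreg) h]
  change MeasurableSet ((fun x : R => normalMap C x) ⁻¹' A)
  rw [this]
  exact measurable_subtype_coe (isCompact_normals C hC A hA).measurableSet

theorem nuT_apply (C : Set E3) (hC : IsCompact C) (r₀ e : E3) (t : ℝ) (A : Set E3)
    (hA : MeasurableSet A) :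
    nuT C r₀ e t A = (μH[2] (Bset C r₀ e t))⁻¹ *
      μH[2] {r : E3 | r ∈ Sset C r₀ e t ∧ IsRegularPt C r ∧ normalMap C r ∈ A} := by
  unfold nuT
  rw [Measure.smul_apply, smul_eq_mul,
    Measure.map_apply_of_aemeasurable (aemeasurable_normalMap C hC r₀ e t) hA,
    Measure.restrict_apply' (measurableSet_Sreg C hC r₀ e t)]
  congr 2
  ext r
  simp only [mem_inter_iff, mem_preimage, mem_ofPred_eq]
  tauto

/-- translated body -/
def shiftBody (C : Set E3) (p : E3) : Set E3 := {x : E3 | p + x ∈ C}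

theorem shift_convex {C : Set E3} (hC : Convex ℝ C) (p : E3) : Convex ℝ (shiftBody C p) := by
  exact hC.translate_preimage_right p

theorem shift_nhds {C : Set E3} {p : E3} (hp : p ∈ interior C) : shiftBody C p ∈ 𝓝 (0 : E3) := by
  have h : C ∈ 𝓝 (p + 0) := by rw [add_zero]; exact mem_interior_iff_mem_nhds.1 hp
  exact (continuous_const.add continuous_id).continuousAt.preimage_mem_nhds h

theorem shift_frontier {C : Set E3} (p r : E3) :
    r ∈ frontier C ↔ r - p ∈ frontier (shiftBody C p) := by
  have : shiftBody C p = (Homeomorph.addLeft p) ⁻¹' C := rfl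
  rw [this, ← Homeomorph.preimage_frontier]
  simp

theorem shift_bdd {C : Set E3} (hC : IsCompact C) (p : E3) :
    ∃ R : ℝ, 0 < R ∧ shiftBody C p ⊆ Metric.closedBall 0 R := by
  obtain ⟨R, hR⟩ := hC.isBounded.subset_closedBall p
  refine ⟨max R 1, by positivity, fun x hx => ?_⟩
  have := hR hx
  simp only [Metric.mem_closedBall, dist_self_add_left] at this
  simp [this]

theorem inner_normal_pos {C : Set E3} {p r n : E3} {ρ : ℝ} (hρ : 0 < ρ)
    (hp : Metric.closedBall p ρ ⊆ C) (hn : IsOutwardNormalAt C r n) : ρ ≤ ⟪r - p, n⟫ := by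
  have h := hn.2 (p + ρ • n) (hp (by simp [norm_smul, hn.1, abs_of_pos hρ]))
  have : p + ρ • n - r = ρ • n - (r - p) := by abel
  rw [this, inner_sub_left, inner_smul_left, real_inner_self_eq_norm_sq, hn.1] at h
  simp at h
  linarith

/-- a supporting functional is bounded by the gauge -/
theorem support_le_gauge {C : Set E3} {p r n : E3} (hp : p ∈ interior C)
    (hn : IsOutwardNormalAt C r n) (hpos : 0 < ⟪r - p, n⟫) (x : E3) :
    ⟪x, n⟫ / ⟪r - p, n⟫ ≤ gauge (shiftBody C p) x := by
  apply le_of_forall_gt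
  intro a ha
  obtain ⟨b, hb, hba, hx⟩ := exists_lt_of_gauge_lt (absorbent_nhds_zero (shift_nhds hp)) ha
  obtain ⟨y, hy, rfl⟩ := hx
  have h := hn.2 (p + y) hy
  have h2 : p + y - r = y - (r - p) := by abel
  rw [h2, inner_sub_left] at h
  simp only [inner_smul_left, RCLike.conj_to_real]
  rw [div_lt_iff₀ hpos]
  nlinarith

theorem exists_normal {C : Set E3} (hC : Convex ℝ C) (hne : (interior C).Nonempty) {r : E3}
    {T : Set E3} (hT : Convex ℝ T) (hTC : Disjoint (interior C) T) (hTr : r ∈ closure T)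
    (hr : r ∈ C) :
    ∃ n, IsOutwardNormalAt C r n ∧ ∀ y ∈ T, ⟪r, n⟫ ≤ ⟪y, n⟫ := by
  obtain ⟨f, a, h1, h2⟩ := geometric_hahn_banach_open hC.interior isOpen_interior hT hTC
  have h3 : ∀ x ∈ C, f x ≤ a := by
    intro x hx
    have : x ∈ closure (interior C) := by
      rw [hC.closure_interior_eq_closure_of_nonempty_interior hne]
      exact subset_closure hx
    have hcl : IsClosed {x | f x ≤ a} := isClosed_le (by fun_prop) (by fun_prop)
    exact closure_minimal (fun y hy => (h1 y hy).le) hcl this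
  have h4 : a ≤ f r := by
    have hcl : IsClosed {x | a ≤ f x} := isClosed_le (by fun_prop) (by fun_prop)
    exact closure_minimal h2 hcl hTr
  have h5 : f r = a := le_antisymm (h3 r hr) h4
  set m := (InnerProductSpace.toDual ℝ E3).symm f with hm
  have hf : ∀ x, f x = ⟪x, m⟫ := by
    intro x
    rw [real_inner_comm, hm, InnerProductSpace.toDual_symm_apply]
  have hm0 : m ≠ 0 := by
    intro h0
    obtain ⟨z, hz⟩ := hne
    have := h1 z hz
    rw [← h5, hf, hf, h0] at this
    simp at this
  have hmn : 0 < ‖m‖ := norm_pos_iff.2 hm0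
  refine ⟨‖m‖⁻¹ • m, ⟨by simp [norm_smul, hmn.ne'], fun x hx => ?_⟩, fun y hy => ?_⟩
  · rw [inner_smul_right, inner_sub_left, ← hf, ← hf]
    have := h3 x hx
    have h6 : 0 < ‖m‖⁻¹ := by positivity
    nlinarith
  · rw [inner_smul_right, inner_smul_right, ← hf, ← hf]
    have := h2 y hy
    have h6 : 0 < ‖m‖⁻¹ := by positivity
    rw [h5]
    gcongr

/-- radial projection from p onto the boundary -/
def radial (C : Set E3) (p : E3) (b : E3) : E3 :=
  p + (gauge (shiftBody C p) (b - p))⁻¹ • (b - p)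

theorem exists_back {C : Set E3} (hC : Convex ℝ C) {r₀ e p : E3} {t : ℝ}
    (hcl : IsClosed C) (hp : p ∈ interior C) (hpos : 0 < ⟪r₀ - p, e⟫ - t)
    {r : E3} (hr : r ∈ Sset C r₀ e t) :
    ∃ b ∈ Bset C r₀ e t, radial C p b = r ∧ ∃ τ : ℝ, 0 < τ ∧ b - p = τ • (r - p) ∧
      gauge (shiftBody C p) (b - p) = τ := by
  have hg : gauge (shiftBody C p) (r - p) = 1 := by
    rw [gauge_eq_one_iff_mem_frontier (shift_convex hC p) (shift_nhds hp)]
    exact (shift_frontier p r).1 hr.1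
  have hrC : r ∈ C := hcl.frontier_subset hr.1
  have h1 : ⟪r - r₀, e⟫ ≥ -t := hr.2
  have h2 : ⟪r - p, e⟫ = ⟪r - r₀, e⟫ + ⟪r₀ - p, e⟫ := by
    rw [← inner_add_left]; congr 1; abel
  have h3 : 0 < ⟪r - p, e⟫ := by linarith
  set τ := (⟪r₀ - p, e⟫ - t) / ⟪r - p, e⟫ with hτ
  have hτ0 : 0 < τ := by positivity
  have hτ1 : τ ≤ 1 := by rw [hτ, div_le_one h3]; linarith
  have hgτ : gauge (shiftBody C p) (τ • (r - p)) = τ := by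
    rw [gauge_smul_of_nonneg hτ0.le, hg]; simp
  refine ⟨p + τ • (r - p), ⟨?_, ?_⟩, ?_, τ, hτ0, ?_, ?_⟩
  · exact hC.add_smul_sub_mem (interior_subset hp) hrC ⟨hτ0.le, hτ1⟩
  · change ⟪p + τ • (r - p) - r₀, e⟫ = -t
    have : p + τ • (r - p) - r₀ = τ • (r - p) - (r₀ - p) := by abel
    rw [this, inner_sub_left, inner_smul_left]
    simp only [RCLike.conj_to_real]
    rw [hτ, div_mul_cancel₀ _ h3.ne']; ring
  · unfold radial
    rw [add_sub_cancel_left, hgτ, smul_smul, inv_mul_cancel₀ hτ0.ne']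
    simp
  · simp
  · rw [add_sub_cancel_left, hgτ]

theorem radial_lip {C : Set E3} (hC : Convex ℝ C) (hcomp : IsCompact C) {r₀ e p : E3}
    (he : ‖e‖ = 1) (hp : p ∈ interior C) (hh : 0 < ⟪r₀ - p, e⟫) :
    ∃ K : NNReal, ∀ t : ℝ, t ≤ ⟪r₀ - p, e⟫ / 2 →
      LipschitzOnWith K (radial C p) (Bset C r₀ e t) := by
  obtain ⟨R, hR, hsub⟩ := shift_bdd hcomp p
  obtain ⟨L, hL⟩ := (shift_convex hC p).lipschitz_gauge (shift_nhds hp)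
  set h := ⟪r₀ - p, e⟫ with hhdef
  set g := gauge (shiftBody C p) with hg
  set m := h / 2 / R with hm
  have hm0 : 0 < m := by positivity
  refine ⟨Real.toNNReal (1 / m + R * L / m ^ 2), fun t ht => ?_⟩
  apply LipschitzOnWith.of_dist_le_mul
  have key : ∀ b ∈ Bset C r₀ e t, m ≤ g (b - p) ∧ ‖b - p‖ ≤ R := by
    intro b hb
    have h1 : b - p ∈ shiftBody C p := by
      change p + (b - p) ∈ C
      rw [add_sub_cancel]; exact hb.1
    have h2 : ‖b - p‖ ≤ R := by simpa using hsub h1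
    refine ⟨?_, h2⟩
    have h3 := le_gauge_of_subset_closedBall (x := b - p) (absorbent_nhds_zero (shift_nhds hp)) hR.le hsub
    refine le_trans ?_ h3
    rw [hm]
    gcongr
    have h4 : ⟪b - p, e⟫ = ⟪b - r₀, e⟫ + ⟪r₀ - p, e⟫ := by
      rw [← inner_add_left]; congr 1; abel
    have h5 : ⟪b - r₀, e⟫ = -t := hb.2
    have h6 := real_inner_le_norm (b - p) e
    rw [he, mul_one] at h6
    linarith
  intro b hb b' hb'
  obtain ⟨k1, k2⟩ := key b hb
  obtain ⟨k1', k2'⟩ := key b' hb'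
  have gp : 0 < g (b - p) := by linarith
  have gp' : 0 < g (b' - p) := by linarith
  have hd : |g (b - p) - g (b' - p)| ≤ L * ‖b - b'‖ := by
    have := hL.dist_le_mul (b - p) (b' - p)
    rw [Real.dist_eq, dist_eq_norm] at this
    simpa using this
  rw [Real.coe_toNNReal _ (by positivity), dist_eq_norm, dist_eq_norm]
  have e1 : radial C p b - radial C p b' = (g (b - p))⁻¹ • (b - b') +
      ((g (b - p))⁻¹ - (g (b' - p))⁻¹) • (b' - p) := by
    unfold radial
    rw [← hg]
    module
  rw [e1]
  refine (norm_add_le _ _).trans ?_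
  rw [norm_smul, norm_smul, Real.norm_of_nonneg (by positivity), add_mul]
  have e2 : ‖(g (b - p))⁻¹ - (g (b' - p))⁻¹‖ ≤ L * ‖b - b'‖ / m ^ 2 := by
    rw [inv_sub_inv gp.ne' gp'.ne', Real.norm_eq_abs, abs_div, abs_sub_comm,
      abs_of_pos (mul_pos gp gp')]
    gcongr
    nlinarith
  have e3 : (g (b - p))⁻¹ ≤ 1 / m := by rw [one_div]; gcongr
  have e4 : ‖(g (b - p))⁻¹ - (g (b' - p))⁻¹‖ * ‖b' - p‖ ≤ L * ‖b - b'‖ / m ^ 2 * R := by gcongr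
  have e5 : (g (b - p))⁻¹ * ‖b - b'‖ ≤ 1 / m * ‖b - b'‖ := by gcongr
  calc _ ≤ 1 / m * ‖b - b'‖ + L * ‖b - b'‖ / m ^ 2 * R := by linarith
    _ = _ := by ring

theorem S_upper {C : Set E3} (hC : Convex ℝ C) (hcomp : IsCompact C) {r₀ e p : E3}
    (he : ‖e‖ = 1) (hp : p ∈ interior C) (hh : 0 < ⟪r₀ - p, e⟫) :
    ∃ K : NNReal, ∀ t : ℝ, t ≤ ⟪r₀ - p, e⟫ / 2 →
      μH[2] (Sset C r₀ e t) ≤ (K : ℝ≥0∞) * μH[2] (Bset C r₀ e t) := by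
  obtain ⟨K, hK⟩ := radial_lip hC hcomp he hp hh
  refine ⟨K ^ 2, fun t ht => ?_⟩
  have h1 : Sset C r₀ e t ⊆ radial C p '' Bset C r₀ e t := by
    intro r hr
    obtain ⟨b, hb, h, -⟩ := exists_back hC hcomp.isClosed hp (by linarith) hr
    exact ⟨b, hb, h⟩
  refine (measure_mono h1).trans ?_
  have := (hK t ht).hausdorffMeasure_image_le (d := 2) (by norm_num)
  refine this.trans (le_of_eq ?_)
  congr 1
  norm_cast

/-- if the gauge is differentiable along the plane, the radial image is a regular point -/
theorem regular_of_diff {C : Set E3} (hC : Convex ℝ C) (hcomp : IsCompact C) {e p r b : E3}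
    (hp : p ∈ interior C) (hr : r ∈ frontier C) {τ : ℝ} (hτ : 0 < τ) (hb : b - p = τ • (r - p))
    (hg : gauge (shiftBody C p) (b - p) = τ) (hbe : ⟪b - p, e⟫ ≠ 0)
    (c : E3) (y : (ℝ ∙ e)ᗮ) (hy : c + y = b - p)
    (hd : DifferentiableAt ℝ (fun z : (ℝ ∙ e)ᗮ => gauge (shiftBody C p) (c + z)) y) :
    IsRegularPt C r := by
  have hrC : r ∈ C := hcomp.isClosed.frontier_subset hr
  obtain ⟨n, hn, -⟩ := exists_normal hC ⟨p, hp⟩ (convex_singleton r)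
    (disjoint_singleton_right.2 hr.2) (subset_closure rfl) hrC
  obtain ⟨ρ, hρ, hball⟩ := Metric.nhds_basis_closedBall.mem_iff.1 (mem_interior_iff_mem_nhds.1 hp)
  have main : ∀ n, IsOutwardNormalAt C r n → ∀ z : (ℝ ∙ e)ᗮ,
      ⟪(z : E3), n⟫ / ⟪r - p, n⟫ =
        fderiv ℝ (fun z : (ℝ ∙ e)ᗮ => gauge (shiftBody C p) (c + z)) y z := by
    intro n hn
    have hpos : 0 < ⟪r - p, n⟫ := hρ.trans_le (inner_normal_pos hρ hball hn)
    set ℓ : (ℝ ∙ e)ᗮ →L[ℝ] ℝ :=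
      (⟪r - p, n⟫)⁻¹ • ((innerSL ℝ n).comp (ℝ ∙ e)ᗮ.subtypeL) with hℓ
    have hℓz : ∀ z, ℓ z = ⟪(z:E3), n⟫ / ⟪r - p, n⟫ := by
      intro z
      simp [hℓ, real_inner_comm]
      ring
    have hder : HasFDerivAt (fun z : (ℝ ∙ e)ᗮ => gauge (shiftBody C p) (c + z) -
        (⟪c, n⟫ / ⟪r - p, n⟫ + ℓ z))
        (fderiv ℝ (fun z : (ℝ ∙ e)ᗮ => gauge (shiftBody C p) (c + z)) y - ℓ) y :=
      hd.hasFDerivAt.sub (ℓ.hasFDerivAt.const_add _)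
    have hmin : IsLocalMin (fun z : (ℝ ∙ e)ᗮ => gauge (shiftBody C p) (c + z) -
        (⟪c, n⟫ / ⟪r - p, n⟫ + ℓ z)) y := by
      have hz : ∀ z : (ℝ ∙ e)ᗮ, ⟪c, n⟫ / ⟪r - p, n⟫ + ℓ z = ⟪c + z, n⟫ / ⟪r - p, n⟫ := by
        intro z; rw [hℓz, inner_add_left]; ring
      refine Filter.Eventually.of_forall fun z => ?_
      simp only [hz]
      rw [hy, hg, hb, inner_smul_left]
      simp only [RCLike.conj_to_real]
      rw [mul_div_assoc, div_self hpos.ne']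
      have := support_le_gauge hp hn hpos (c + z)
      linarith
    have h0 := hmin.hasFDerivAt_eq_zero hder
    intro z
    rw [← hℓz, sub_eq_zero.1 h0]
  refine ⟨n, hn, fun n' hn' => ?_⟩
  have hpos : 0 < ⟪r - p, n⟫ := hρ.trans_le (inner_normal_pos hρ hball hn)
  have hpos' : 0 < ⟪r - p, n'⟫ := hρ.trans_le (inner_normal_pos hρ hball hn')
  have hrpe : ⟪r - p, e⟫ ≠ 0 := by
    intro h0; apply hbe; rw [hb, inner_smul_left, h0, mul_zero]
  have heq : ∀ x : E3, ⟪x, n⟫ / ⟪r - p, n⟫ = ⟪x, n'⟫ / ⟪r - p, n'⟫ := by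
    intro x
    set a := ⟪x, e⟫ / ⟪r - p, e⟫ with ha
    have hz : x - a • (r - p) ∈ (ℝ ∙ e)ᗮ := by
      rw [mem_perp, inner_sub_left, inner_smul_left]
      simp only [RCLike.conj_to_real]
      rw [ha, div_mul_cancel₀ _ hrpe, sub_self]
    have h1 := (main n hn ⟨_, hz⟩).trans (main n' hn' ⟨_, hz⟩).symm
    simp only [inner_sub_left x, inner_smul_left, RCLike.conj_to_real] at h1
    rw [sub_div, sub_div, mul_div_assoc, mul_div_assoc, div_self hpos.ne',
      div_self hpos'.ne'] at h1
    linarith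
  have hvec : (⟪r - p, n⟫)⁻¹ • n = (⟪r - p, n'⟫)⁻¹ • n' := by
    apply ext_inner_left ℝ
    intro x
    rw [inner_smul_right, inner_smul_right]
    have := heq x
    rw [div_eq_inv_mul, div_eq_inv_mul] at this
    exact this
  have hnorm := congrArg norm hvec
  rw [norm_smul, norm_smul, hn.1, hn'.1, Real.norm_of_nonneg (by positivity),
    Real.norm_of_nonneg (by positivity), mul_one, mul_one] at hnorm
  rw [hnorm] at hvec
  exact (smul_right_injective E3 (inv_pos.2 hpos').ne' hvec).symm

theorem nonreg_null {C : Set E3} (hC : Convex ℝ C) (hcomp : IsCompact C) {r₀ e p : E3}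
    (he : ‖e‖ = 1) (hp : p ∈ interior C) (hh : 0 < ⟪r₀ - p, e⟫) (t : ℝ)
    (ht : t ≤ ⟪r₀ - p, e⟫ / 2) :
    μH[2] (Sset C r₀ e t ∩ {r | ¬ IsRegularPt C r}) = 0 := by
  obtain ⟨K, hK⟩ := radial_lip hC hcomp he hp hh
  obtain ⟨L, hL⟩ := (shift_convex hC p).lipschitz_gauge (shift_nhds hp)
  have := haus_haar e he
  set c : E3 := r₀ - t • e - p with hc
  set φ : (ℝ ∙ e)ᗮ → ℝ := fun z => gauge (shiftBody C p) (c + z) with hφ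
  have hφL : LipschitzWith L φ := by
    apply LipschitzWith.of_dist_le_mul
    intro x y
    have := hL.dist_le_mul (c + x) (c + y)
    simpa [hφ, Subtype.dist_eq] using this
  have hae : ∀ᵐ z ∂(μH[2] : Measure (ℝ ∙ e)ᗮ), DifferentiableAt ℝ φ z := hφL.ae_differentiableAt
  set N : Set (ℝ ∙ e)ᗮ := {z | ¬ DifferentiableAt ℝ φ z} with hN
  have hN0 : μH[2] N = 0 := hae
  have hiso : Isometry (fun z : (ℝ ∙ e)ᗮ => (p + c + z : E3)) := by
    apply Isometry.of_dist_eq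
    intro x y
    simp [Subtype.dist_eq]
  have h1 : μH[2] ((fun z : (ℝ ∙ e)ᗮ => (p + c + z : E3)) '' N) = 0 := by
    rw [hiso.hausdorffMeasure_image (Or.inl (by norm_num)), hN0]
  have h2 : μH[2] (radial C p '' (Bset C r₀ e t ∩
      (fun z : (ℝ ∙ e)ᗮ => (p + c + z : E3)) '' N)) = 0 := by
    have := ((hK t ht).mono (inter_subset_left (t := (fun z : (ℝ ∙ e)ᗮ => (p + c + z : E3)) '' N))).hausdorffMeasure_image_le
      (d := 2) (by norm_num)
    rw [measure_mono_null inter_subset_right h1, mul_zero] at this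
    exact le_antisymm this (by simp)
  refine measure_mono_null ?_ h2
  rintro r ⟨hr, hnr⟩
  obtain ⟨b, hb, hbr, τ, hτ, hbp, hg⟩ := exists_back hC hcomp.isClosed hp (by linarith) hr
  have hbe : ⟪b - r₀, e⟫ = -t := hb.2
  have hmem : b - p - c ∈ (ℝ ∙ e)ᗮ := by
    rw [mem_perp]
    have : b - p - c = b - r₀ + t • e := by rw [hc]; abel
    rw [this, inner_add_left, hbe, inner_smul_left, real_inner_self_eq_norm_sq, he]
    simp
  refine ⟨b, ⟨hb, ⟨b - p - c, hmem⟩, ?_, by simp⟩, hbr⟩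
  intro hd
  apply hnr
  refine regular_of_diff hC hcomp hp hr.1 hτ hbp hg (e := e) ?_ c ⟨b - p - c, hmem⟩ (by simp) hd
  have : b - p = (b - r₀) + (r₀ - p) := by abel
  rw [this, inner_add_left, hbe]
  linarith

lemma back_point {C : Set E3} (hC : Convex ℝ C) (hcomp : IsCompact C)
    (hne : (interior C).Nonempty) {v : E3} (hv : v ≠ 0) {q : E3} (hq : q ∈ C) :
    ∃ s : ℝ, q - s • v ∈ frontier C ∧
      ∃ n, IsOutwardNormalAt C (q - s • v) n ∧ ⟪n, v⟫ ≤ 0 := by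
  obtain ⟨R, hR⟩ := hcomp.isBounded.exists_norm_le
  have hv' : 0 < ‖v‖ := norm_pos_iff.2 hv
  have hcl : IsClosed {s : ℝ | q - s • v ∈ C} :=
    hcomp.isClosed.preimage (f := fun s : ℝ => q - s • v) (by fun_prop)
  have hK : IsCompact (Icc (0:ℝ) ((‖q‖ + R) / ‖v‖) ∩ {s : ℝ | q - s • v ∈ C}) :=
    isCompact_Icc.inter_right hcl
  have hR0 : 0 ≤ R := (norm_nonneg q).trans (hR q hq)
  have hn0 : (Icc (0:ℝ) ((‖q‖ + R) / ‖v‖) ∩ {s : ℝ | q - s • v ∈ C}).Nonempty :=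
    ⟨0, ⟨le_rfl, by positivity⟩, by simpa using hq⟩
  obtain ⟨s, ⟨⟨hs0, hs1⟩, hsC⟩, hmax⟩ := hK.exists_isMaxOn hn0 continuousOn_id
  have hsC' : q - s • v ∈ C := hsC
  have hout : ∀ s' : ℝ, 0 < s' → (q - s • v) - s' • v ∉ C := by
    intro s' hs' hmem
    have h1 : (q - s • v) - s' • v = q - (s + s') • v := by rw [add_smul]; abel
    rw [h1] at hmem
    have h2 : s + s' ≤ (‖q‖ + R) / ‖v‖ := by
      rw [le_div_iff₀ hv']
      have h3 := hR _ hmem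
      have h4 : ‖(s + s') • v‖ ≤ ‖q‖ + ‖q - (s + s') • v‖ := by
        have := norm_sub_le q (q - (s + s') • v)
        simpa using this
      rw [norm_smul, Real.norm_eq_abs, abs_of_nonneg (by linarith)] at h4
      linarith
    have h5 := hmax (show s + s' ∈ _ from ⟨⟨by linarith, h2⟩, hmem⟩)
    simp only [id] at h5
    have : s + s' ≤ s := h5
    linarith
  set r := q - s • v with hr
  let T : Set E3 := (fun s' : ℝ => r - s' • v) '' Ioi 0
  have hTconv : Convex ℝ T := by
    rintro _ ⟨a, ha, rfl⟩ _ ⟨b, hb, rfl⟩ x y hx hy hxy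
    refine ⟨x * a + y * b, ?_, ?_⟩
    · exact (convex_Ioi (0:ℝ)) ha hb hx hy hxy
    · simp only [smul_sub, add_smul, smul_smul]
      have : r = x • r + y • r := by rw [← add_smul, hxy, one_smul]
      conv_lhs => rw [this]
      abel
  have hTC : T ⊆ Cᶜ := by
    rintro _ ⟨a, ha, rfl⟩
    exact hout a ha
  have hTr : r ∈ closure T := by
    have hc : Continuous (fun s' : ℝ => r - s' • v) := by fun_prop
    have h0 : (0:ℝ) ∈ closure (Ioi (0:ℝ)) := by simp
    have := image_closure_subset_closure_image hc (mem_image_of_mem _ h0)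
    simpa using this
  refine ⟨s, ?_, ?_⟩
  · rw [frontier_eq_closure_inter_closure]
    exact ⟨subset_closure hsC', closure_mono hTC hTr⟩
  · obtain ⟨n, hn, hn'⟩ := exists_normal hC hne hTconv
      (Set.disjoint_left.2 fun x hx hxT => hTC hxT (interior_subset hx)) hTr hsC'
    refine ⟨n, hn, ?_⟩
    have := hn' (r - (1:ℝ) • v) ⟨1, by simp, rfl⟩
    rw [one_smul, inner_sub_left (𝕜 := ℝ) r v n] at this
    rw [real_inner_comm]; linarith

lemma back_lower {C : Set E3} (hC : Convex ℝ C) (hcomp : IsCompact C) {r₀ e e₁ e₂ p : E3}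
    {l₁ l₂ a₁ a₂ : ℝ} (hl₁ : 0 < l₁) (hl₂ : 0 < l₂) (ha₁ : 0 < a₁) (ha₂ : 0 < a₂)
    (hed : e = l₁ • e₁ + l₂ • e₂)
    (he : ‖e‖ = 1) (hp : p ∈ interior C) (hh : 0 < ⟪r₀ - p, e⟫) (hr₀ : r₀ ∈ C)
    (h1 : ∀ x ∈ C, ⟪x - r₀, e₁⟫ ≤ 0) (h2 : ∀ x ∈ C, ⟪x - r₀, e₂⟫ ≤ 0)
    {v : E3} (hv : ⟪a₁ • e₁ + a₂ • e₂, v⟫ = 0) (hev : ⟪e, v⟫ ≠ 0) :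
    ∃ c : ℝ≥0∞, 0 < c ∧ c < ⊤ ∧ ∀ t, 0 < t → t ≤ ⟪r₀ - p, e⟫ / 2 →
      c * μH[2] (Bset C r₀ e t) ≤
        μH[2] {r | r ∈ Sset C r₀ e t ∧ IsRegularPt C r ∧ ⟪normalMap C r, v⟫ ≤ 0} := by
  have hv0 : v ≠ 0 := by rintro rfl; simp at hev
  set M := l₁ / a₁ + l₂ / a₂ with hM
  set N := a₁ / l₁ + a₂ / l₂ with hN
  have hMpos : 0 < M := by positivity
  have hNpos : 0 < N := by positivity
  have hMN : 1 ≤ M * N := by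
    have : (l₁ / a₁) * (a₁ / l₁) = 1 := by field_simp
    have h3 : 0 < l₁ / a₁ := by positivity
    have h4 : 0 < l₂ / a₂ := by positivity
    have h5 : 0 < a₁ / l₁ := by positivity
    have h6 : 0 < a₂ / l₂ := by positivity
    rw [hM, hN]; nlinarith [mul_pos h3 h6, mul_pos h4 h5, mul_pos h4 h6]
  set k := (M * N)⁻¹ with hk
  have hkpos : 0 < k := by positivity
  have hk1 : k ≤ 1 := inv_le_one_of_one_le₀ hMN
  -- oblique projection
  let P : E3 → E3 := fun x => x - (⟪x, e⟫ / ⟪v, e⟫) • v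
  have hve : ⟪v, e⟫ ≠ 0 := by rwa [real_inner_comm]
  have hPv : ∀ x (s : ℝ), P (x - s • v) = P x := by
    intro x s
    simp only [P, inner_sub_left, real_inner_smul_left, sub_div, mul_div_assoc, div_self hve,
      mul_one, sub_smul]
    abel
  let Kp : NNReal := ⟨1 + ‖v‖ / |⟪v, e⟫|, by positivity⟩
  have hPlip : LipschitzWith Kp P := by
    refine LipschitzWith.of_dist_le_mul fun x y => ?_
    rw [dist_eq_norm, dist_eq_norm]
    have : P x - P y = (x - y) - (⟪x - y, e⟫ / ⟪v, e⟫) • v := by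
      simp only [P, inner_sub_left, sub_div, sub_smul]; abel
    rw [this]
    refine (norm_sub_le _ _).trans ?_
    rw [norm_smul, Real.norm_eq_abs, abs_div]
    have h3 : |⟪x - y, e⟫| ≤ ‖x - y‖ := by
      have := abs_real_inner_le_norm (x - y) e
      rwa [he, mul_one] at this
    have h4 : |⟪x - y, e⟫| / |⟪v, e⟫| * ‖v‖ ≤ ‖x - y‖ / |⟪v, e⟫| * ‖v‖ := by gcongr
    calc ‖x - y‖ + |⟪x - y, e⟫| / |⟪v, e⟫| * ‖v‖ ≤ ‖x - y‖ + ‖x - y‖ / |⟪v, e⟫| * ‖v‖ := by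
          linarith
      _ = (1 + ‖v‖ / |⟪v, e⟫|) * ‖x - y‖ := by ring
  have hKp0 : (Kp : ℝ≥0∞) ≠ 0 := by
    have : (0:ℝ) < Kp := by change (0:ℝ) < 1 + ‖v‖ / |⟪v, e⟫|; positivity
    have h' : 0 < Kp := by exact_mod_cast this
    exact_mod_cast h'.ne'
  have hKp2 : (Kp : ℝ≥0∞) ^ (2:ℝ) ≠ 0 := by
    intro h; rw [ENNReal.rpow_eq_zero_iff] at h; rcases h with h | h
    · exact hKp0 h.1
    · exact ENNReal.coe_ne_top h.1
  have hKp2' : (Kp : ℝ≥0∞) ^ (2:ℝ) ≠ ⊤ := ENNReal.rpow_ne_top_of_nonneg (by norm_num) ENNReal.coe_ne_top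
  refine ⟨((Kp : ℝ≥0∞) ^ (2:ℝ))⁻¹ * ENNReal.ofReal (k ^ 2), ?_, ?_, ?_⟩
  · refine ENNReal.mul_pos (ENNReal.inv_ne_zero.2 hKp2') ?_
    simp only [ne_eq, ENNReal.ofReal_eq_zero, not_le]; positivity
  · exact ENNReal.mul_lt_top (ENNReal.inv_lt_top.2 (pos_iff_ne_zero.2 hKp2)) ENNReal.ofReal_lt_top
  intro t ht htp
  set Y := {r | r ∈ Sset C r₀ e t ∧ IsRegularPt C r ∧ ⟪normalMap C r, v⟫ ≤ 0} with hY
  set Q := (fun x => r₀ + k • (x - r₀)) '' Bset C r₀ e t with hQ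
  have hQm : μH[2] Q = ENNReal.ofReal (k ^ 2) * μH[2] (Bset C r₀ e t) :=
    haus_homothety r₀ k hkpos _
  have hPQ : μH[2] (P '' Q) = μH[2] Q := by
    have : P '' Q = (fun x => (-((⟪r₀, e⟫ - k * t) / ⟪v, e⟫) • v) + x) '' Q := by
      apply image_congr
      rintro _ ⟨x, hx, rfl⟩
      have hx2 : ⟪x - r₀, e⟫ = -t := hx.2
      simp only [P, inner_add_left, real_inner_smul_left, hx2]
      rw [show ⟪r₀, e⟫ + k * -t = ⟪r₀, e⟫ - k * t by ring, neg_smul]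
      abel
    rw [this, haus_vadd]
  have hsub : P '' Q ⊆ P '' Y ∪ P '' (Sset C r₀ e t ∩ {r | ¬ IsRegularPt C r}) := by
    rintro _ ⟨_, ⟨x, hx, rfl⟩, rfl⟩
    have hx2 : ⟪x - r₀, e⟫ = -t := hx.2
    set q := r₀ + k • (x - r₀) with hq
    have hqC : q ∈ C := by
      have := hC hr₀ hx.1 (show 0 ≤ 1 - k by linarith) hkpos.le (by ring)
      convert this using 1
      rw [hq, smul_sub, sub_smul, one_smul]; abel
    obtain ⟨s, hfr, n, hn, hnv⟩ := back_point hC hcomp ⟨p, hp⟩ hv0 hqC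
    set r := q - s • v with hr
    have hrC : r ∈ C := hcomp.isClosed.frontier_subset hfr
    have hw : a₁ * ⟪r - r₀, e₁⟫ + a₂ * ⟪r - r₀, e₂⟫ = a₁ * ⟪q - r₀, e₁⟫ + a₂ * ⟪q - r₀, e₂⟫ := by
      have h3 : r - r₀ = (q - r₀) - s • v := by rw [hr]; abel
      rw [h3, inner_sub_left (𝕜 := ℝ) (q - r₀) (s • v), inner_sub_left (𝕜 := ℝ) (q - r₀) (s • v),
        real_inner_smul_left, real_inner_smul_left]
      have h4 : a₁ * ⟪v, e₁⟫ + a₂ * ⟪v, e₂⟫ = 0 := by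
        rw [real_inner_comm, inner_add_right, real_inner_smul_right, real_inner_smul_right] at hv
        exact hv
      linear_combination (-s) * h4
    have hqe : l₁ * ⟪q - r₀, e₁⟫ + l₂ * ⟪q - r₀, e₂⟫ = -(k * t) := by
      have : ⟪q - r₀, e⟫ = -(k * t) := by
        rw [hq, add_sub_cancel_left, real_inner_smul_left, hx2]; ring
      rw [hed, inner_add_right, real_inner_smul_right, real_inner_smul_right] at this
      exact this
    have hre : ⟪r - r₀, e⟫ ≥ -t := by
      rw [hed, inner_add_right, real_inner_smul_right, real_inner_smul_right]
      have A := h1 r hrC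
      have B := h2 r hrC
      have A' := h1 q hqC
      have B' := h2 q hqC
      have M1 : l₁ ≤ M * a₁ := by
        have : M * a₁ = l₁ + l₂ / a₂ * a₁ := by rw [hM]; field_simp
        rw [this]; have : 0 < l₂ / a₂ * a₁ := by positivity
        linarith
      have M2 : l₂ ≤ M * a₂ := by
        have : M * a₂ = l₂ + l₁ / a₁ * a₂ := by rw [hM]; field_simp; ring
        rw [this]; have : 0 < l₁ / a₁ * a₂ := by positivity
        linarith
      have N1 : a₁ ≤ N * l₁ := by
        have : N * l₁ = a₁ + a₂ / l₂ * l₁ := by rw [hN]; field_simp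
        rw [this]; have : 0 < a₂ / l₂ * l₁ := by positivity
        linarith
      have N2 : a₂ ≤ N * l₂ := by
        have : N * l₂ = a₂ + a₁ / l₁ * l₂ := by rw [hN]; field_simp; ring
        rw [this]; have : 0 < a₁ / l₁ * l₂ := by positivity
        linarith
      have s1 : l₁ * ⟪r - r₀, e₁⟫ + l₂ * ⟪r - r₀, e₂⟫ ≥
          M * (a₁ * ⟪r - r₀, e₁⟫ + a₂ * ⟪r - r₀, e₂⟫) := by nlinarith
      have s2 : a₁ * ⟪q - r₀, e₁⟫ + a₂ * ⟪q - r₀, e₂⟫ ≥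
          N * (l₁ * ⟪q - r₀, e₁⟫ + l₂ * ⟪q - r₀, e₂⟫) := by nlinarith
      rw [hqe] at s2
      rw [hw] at s1
      have s3 := mul_le_mul_of_nonneg_left s2 hMpos.le
      have s4 : M * (N * -(k * t)) = -t := by
        have : M * N * k = 1 := mul_inv_cancel₀ (by positivity)
        linear_combination (-t) * this
      linarith
    have hrS : r ∈ Sset C r₀ e t := ⟨hfr, hre⟩
    have hPr : P r = P q := hPv q s
    by_cases hreg : IsRegularPt C r
    · left
      refine ⟨r, ⟨hrS, hreg, ?_⟩, hPr⟩
      rw [hreg.unique (normalMap_spec C r hreg) hn]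
      exact hnv
    · right
      exact ⟨r, ⟨hrS, hreg⟩, hPr⟩
  have hnull : μH[2] (P '' (Sset C r₀ e t ∩ {r | ¬ IsRegularPt C r})) = 0 := by
    have := hPlip.hausdorffMeasure_image_le (d := 2) (by norm_num)
      (Sset C r₀ e t ∩ {r | ¬ IsRegularPt C r})
    rw [nonreg_null hC hcomp he hp hh t htp, mul_zero] at this
    simpa using this
  have hfin : ENNReal.ofReal (k ^ 2) * μH[2] (Bset C r₀ e t) ≤ (Kp : ℝ≥0∞) ^ (2:ℝ) * μH[2] Y := by
    rw [← hQm, ← hPQ]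
    calc μH[2] (P '' Q) ≤ μH[2] (P '' Y) + _ := (measure_mono hsub).trans (measure_union_le _ _)
      _ = μH[2] (P '' Y) := by rw [hnull, add_zero]
      _ ≤ _ := hPlip.hausdorffMeasure_image_le (by norm_num) _
  rw [mul_assoc]
  calc ((Kp : ℝ≥0∞) ^ (2:ℝ))⁻¹ * (ENNReal.ofReal (k ^ 2) * μH[2] (Bset C r₀ e t))
      ≤ ((Kp : ℝ≥0∞) ^ (2:ℝ))⁻¹ * ((Kp : ℝ≥0∞) ^ (2:ℝ) * μH[2] Y) := by gcongr
    _ = μH[2] Y := by rw [← mul_assoc, ENNReal.inv_mul_cancel hKp2 hKp2', one_mul]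

lemma inner_abs_lt {e₁ e₂ : E3} (he₁ : ‖e₁‖ = 1) (he₂ : ‖e₂‖ = 1) (hne : e₁ ≠ e₂)
    (hne' : e₁ ≠ -e₂) : -1 < ⟪e₁, e₂⟫ ∧ ⟪e₁, e₂⟫ < 1 := by
  have h1 := (inner_lt_one_iff_real_of_norm_eq_one he₁ he₂).2 hne
  have h2 := (inner_lt_one_iff_real_of_norm_eq_one he₁ (by rwa [norm_neg] : ‖-e₂‖ = 1)).2 hne'
  rw [inner_neg_right] at h2
  exact ⟨by linarith, h1⟩

lemma exists_u (e₁ e₂ : E3) : ∃ u : E3, ‖u‖ = 1 ∧ ⟪e₁, u⟫ = 0 ∧ ⟪e₂, u⟫ = 0 := by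
  let L : E3 →ₗ[ℝ] ℝ × ℝ := ((innerSL ℝ e₁).toLinearMap).prod ((innerSL ℝ e₂).toLinearMap)
  have hk : L.ker ≠ ⊥ := by
    apply LinearMap.ker_ne_bot_of_finrank_lt
    simp
  obtain ⟨x, hx, hx0⟩ := Submodule.exists_mem_ne_zero_of_ne_bot hk
  have hx' : ⟪e₁, x⟫ = 0 ∧ ⟪e₂, x⟫ = 0 := by
    have := LinearMap.mem_ker.1 hx
    simpa [L, Prod.ext_iff] using this
  have hn : ‖x‖ ≠ 0 := norm_ne_zero_iff.2 hx0
  refine ⟨‖x‖⁻¹ • x, ?_, ?_, ?_⟩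
  · rw [norm_smul, norm_inv, norm_norm, inv_mul_cancel₀ hn]
  · rw [real_inner_smul_right, hx'.1, mul_zero]
  · rw [real_inner_smul_right, hx'.2, mul_zero]

lemma disc_pos (u : E3) (hu : ‖u‖ = 1) (R : ℝ) (hR : 0 < R) :
    0 < μH[2] {x : E3 | ⟪x, u⟫ = 0 ∧ ‖x‖ ≤ R} := by
  have := haus_haar u hu
  rw [disc_eq, (isometry_subtype_coe).hausdorffMeasure_image (Or.inl (by norm_num))]
  exact Metric.measure_closedBall_pos _ _ hR

lemma B_lt_top {C : Set E3} (hcomp : IsCompact C) {r₀ e : E3} (he : ‖e‖ = 1) (t : ℝ) :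
    μH[2] (Bset C r₀ e t) < ⊤ := by
  obtain ⟨R, hR⟩ := hcomp.isBounded.exists_norm_le
  refine lt_of_le_of_lt ?_ (disc_lt_top e he (R + ‖r₀ - t • e‖))
  rw [← haus_vadd (r₀ - t • e) {x : E3 | ⟪x, e⟫ = 0 ∧ ‖x‖ ≤ R + ‖r₀ - t • e‖}]
  refine measure_mono fun x hx => ⟨x - (r₀ - t • e), ⟨?_, ?_⟩, by simp⟩
  · have h2 : ⟪x - r₀, e⟫ = -t := hx.2
    rw [show x - (r₀ - t • e) = (x - r₀) + t • e by abel, inner_add_left (𝕜 := ℝ) (x - r₀), h2,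
      real_inner_smul_left, real_inner_self_eq_norm_sq, he]; ring
  · exact (norm_sub_le _ _).trans (by linarith [hR x hx.1])

lemma convex_rays {C : Set E3} (hC : Convex ℝ C) (r₀ : E3) :
    Convex ℝ {v : E3 | ∃ c : ℝ, ∃ r ∈ C, 0 ≤ c ∧ v = c • (r - r₀)} := by
  rintro _ ⟨c, r, hr, hc, rfl⟩ _ ⟨d, s, hs, hd, rfl⟩ a b ha hb hab
  have hac : 0 ≤ a * c := mul_nonneg ha hc
  have hbd : 0 ≤ b * d := mul_nonneg hb hd
  rcases eq_or_lt_of_le (add_nonneg hac hbd) with h | h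
  · have h1 : a * c = 0 := by linarith
    have h2 : b * d = 0 := by linarith
    exact ⟨0, r, hr, le_rfl, by simp [smul_smul, h1, h2]⟩
  · refine ⟨a * c + b * d, (a * c / (a * c + b * d)) • r + (b * d / (a * c + b * d)) • s,
      hC hr hs (by positivity) (by positivity) (by field_simp), h.le, ?_⟩
    have A1 : (a * c + b * d) * (a * c / (a * c + b * d)) = a * c := by field_simp
    have A2 : (a * c + b * d) * (b * d / (a * c + b * d)) = b * d := by field_simp
    simp only [smul_sub, smul_add, smul_smul, A1, A2, add_smul]
    abel

lemma ray_mem {C : Set E3} (hC : Convex ℝ C) (hne : (interior C).Nonempty) {r₀ e₁ e₂ : E3}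
    (hr₀ : r₀ ∈ C)
    (hcone : tanCone C r₀ = dihedral e₁ e₂) {x : E3} (h1 : ⟪x, e₁⟫ < 0) (h2 : ⟪x, e₂⟫ < 0) :
    ∃ n : ℕ, r₀ + ((n:ℝ) + 1)⁻¹ • x ∈ C := by
  have hi : x ∈ interior (tanCone C r₀) := by
    rw [hcone]
    refine interior_maximal (t := {x | ⟪x, e₁⟫ < 0} ∩ {x | ⟪x, e₂⟫ < 0}) ?_ ?_ ⟨h1, h2⟩
    · exact fun y hy => ⟨le_of_lt hy.1, le_of_lt hy.2⟩
    · exact (isOpen_lt (by fun_prop) (by fun_prop)).inter (isOpen_lt (by fun_prop) (by fun_prop))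
  rw [tanCone, (convex_rays hC r₀).interior_closure_eq_interior_of_nonempty_interior] at hi
  · obtain ⟨c, r, hr, hc, rfl⟩ := interior_subset hi
    obtain ⟨n, hn⟩ := exists_nat_ge c
    refine ⟨n, ?_⟩
    have hn1 : (0:ℝ) < n + 1 := by positivity
    have h3 : ((n:ℝ) + 1)⁻¹ * c ≤ 1 := by
      rw [inv_mul_le_iff₀ hn1]; linarith
    have := hC hr₀ hr (show 0 ≤ 1 - ((n:ℝ) + 1)⁻¹ * c by linarith)
      (show 0 ≤ ((n:ℝ) + 1)⁻¹ * c by positivity) (by ring)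
    convert this using 1
    rw [smul_smul, smul_sub, sub_smul, one_smul]; abel
  · obtain ⟨p, hp⟩ := hne
    refine ⟨p - r₀, interior_mono (s := (fun y => y + r₀) ⁻¹' C) ?_ ?_⟩
    · intro y hy
      exact ⟨1, y + r₀, hy, zero_le_one, by simp⟩
    · refine preimage_interior_subset_interior_preimage (by fun_prop) ?_
      simpa using hp

lemma wedge_top {e e₁ e₂ u : E3} {l₁ l₂ : ℝ} (hl₁ : 0 < l₁) (hl₂ : 0 < l₂)
    (he₁ : ‖e₁‖ = 1) (he₂ : ‖e₂‖ = 1) (hne : e₁ ≠ e₂) (hne' : e₁ ≠ -e₂)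
    (hed : e = l₁ • e₁ + l₂ • e₂) (he : ‖e‖ = 1) (hu : ‖u‖ = 1) (hu1 : ⟪e₁, u⟫ = 0)
    (hu2 : ⟪e₂, u⟫ = 0) :
    μH[2] {x : E3 | ⟪x, e⟫ = -1 ∧ ⟪x, e₁⟫ < 0 ∧ ⟪x, e₂⟫ < 0} = ⊤ := by
  obtain ⟨hg, -⟩ := inner_abs_lt he₁ he₂ hne hne'
  set g := ⟪e₁, e₂⟫ with hgdef
  have hg' : ⟪e₂, e₁⟫ = g := by rw [real_inner_comm]
  have h11 : ⟪e₁, e₁⟫ = 1 := by rw [real_inner_self_eq_norm_sq, he₁]; norm_num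
  have h22 : ⟪e₂, e₂⟫ = 1 := by rw [real_inner_self_eq_norm_sq, he₂]; norm_num
  have hu1' : ⟪u, e₁⟫ = 0 := by rw [real_inner_comm]; exact hu1
  have hu2' : ⟪u, e₂⟫ = 0 := by rw [real_inner_comm]; exact hu2
  have hue : ⟪u, e⟫ = 0 := by
    rw [hed, inner_add_right, real_inner_smul_right, real_inner_smul_right, hu1', hu2']; ring
  set b := ((l₁ + l₂) * (1 + g))⁻¹ with hb
  have hg1 : 0 < 1 + g := by linarith
  set ε := (l₁ + l₂)⁻¹ / 2 with hε
  have hεpos : 0 < ε := by positivity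
  have hbg : b * (1 + g) = 2 * ε := by rw [hb, hε]; field_simp
  set v0 := (-b) • (e₁ + e₂) with hv0
  have hv1 : ⟪v0, e₁⟫ = -(2 * ε) := by
    rw [hv0, real_inner_smul_left, inner_add_left, h11, hg', ← hbg]; ring
  have hv2 : ⟪v0, e₂⟫ = -(2 * ε) := by
    rw [hv0, real_inner_smul_left, inner_add_left, h22, ← hgdef, ← hbg]; ring
  have hve : ⟪v0, e⟫ = -1 := by
    rw [hed, inner_add_right, real_inner_smul_right, real_inner_smul_right, hv1, hv2, hε]
    field_simp
    ring
  let D := {x : E3 | ⟪x, e⟫ = 0 ∧ ‖x‖ ≤ ε}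
  have hDc : IsClosed D :=
    IsClosed.inter (s₁ := {x : E3 | ⟪x, e⟫ = 0}) (s₂ := {x : E3 | ‖x‖ ≤ ε})
      (isClosed_eq (by fun_prop) (by fun_prop)) (isClosed_le (by fun_prop) (by fun_prop))
  let F : ℕ → Set E3 := fun j => (fun x => (v0 + ((j:ℝ) * (3 * ε)) • u) + x) '' D
  have hFm : ∀ j, MeasurableSet (F j) := fun j =>
    ((Homeomorph.addLeft (v0 + ((j:ℝ) * (3 * ε)) • u)).isClosedMap D hDc).measurableSet
  have hFd : Pairwise (fun i j => Disjoint (F i) (F j)) := by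
    intro i j hij
    rw [Set.disjoint_left]
    rintro _ ⟨x, hx, rfl⟩ ⟨y, hy, hxy⟩
    have h3 : ⟪(v0 + ((j:ℝ) * (3 * ε)) • u) + y, u⟫ = ⟪(v0 + ((i:ℝ) * (3 * ε)) • u) + x, u⟫ := by
      exact congrArg (fun z => ⟪z, u⟫) hxy
    have huu : ⟪u, u⟫ = 1 := by rw [real_inner_self_eq_norm_sq, hu]; norm_num
    simp only [inner_add_left, real_inner_smul_left, huu] at h3
    have hx' := abs_real_inner_le_norm x u
    have hy' := abs_real_inner_le_norm y u
    rw [hu, mul_one] at hx' hy'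
    have hx'' := abs_le.1 (hx'.trans hx.2)
    have hy'' := abs_le.1 (hy'.trans hy.2)
    rcases Nat.lt_or_gt_of_ne hij with h | h
    · have : (i:ℝ) + 1 ≤ j := by exact_mod_cast h
      nlinarith
    · have : (j:ℝ) + 1 ≤ i := by exact_mod_cast h
      nlinarith
  have hsub : (⋃ j, F j) ⊆ {x : E3 | ⟪x, e⟫ = -1 ∧ ⟪x, e₁⟫ < 0 ∧ ⟪x, e₂⟫ < 0} := by
    refine iUnion_subset fun j => ?_
    rintro _ ⟨x, hx, rfl⟩
    have hx1 := abs_real_inner_le_norm x e₁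
    have hx2 := abs_real_inner_le_norm x e₂
    rw [he₁, mul_one] at hx1
    rw [he₂, mul_one] at hx2
    have hx1' := abs_le.1 (hx1.trans hx.2)
    have hx2' := abs_le.1 (hx2.trans hx.2)
    refine ⟨?_, ?_, ?_⟩
    · simp only [inner_add_left, real_inner_smul_left, hve, hue, hx.1]; ring
    · simp only [inner_add_left, real_inner_smul_left, hv1, hu1']; linarith
    · simp only [inner_add_left, real_inner_smul_left, hv2, hu2']; linarith
  refine top_le_iff.1 (le_trans ?_ (measure_mono hsub))
  rw [measure_iUnion hFd hFm]
  have : ∀ j, μH[2] (F j) = μH[2] D := fun j => haus_vadd _ _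
  simp only [this]
  rw [ENNReal.tsum_const_eq_top_of_ne_zero (disc_pos e he ε hεpos).ne']

lemma B_growth {C : Set E3} (hC : Convex ℝ C) (hint : (interior C).Nonempty)
    {r₀ e e₁ e₂ u : E3} (hr₀ : r₀ ∈ C)
    {l₁ l₂ : ℝ} (hl₁ : 0 < l₁) (hl₂ : 0 < l₂)
    (he₁ : ‖e₁‖ = 1) (he₂ : ‖e₂‖ = 1) (hne : e₁ ≠ e₂) (hne' : e₁ ≠ -e₂)
    (hed : e = l₁ • e₁ + l₂ • e₂) (he : ‖e‖ = 1) (hu : ‖u‖ = 1) (hu1 : ⟪e₁, u⟫ = 0)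
    (hu2 : ⟪e₂, u⟫ = 0) (hcone : tanCone C r₀ = dihedral e₁ e₂) (A : ℝ≥0∞) (hA : A < ⊤) :
    ∃ t₀ : ℝ, 0 < t₀ ∧ ∀ t, 0 < t → t ≤ t₀ →
      ENNReal.ofReal (t ^ 2) * A ≤ μH[2] (Bset C r₀ e t) := by
  let X : ℕ → Set E3 := fun n => {x | ⟪x, e⟫ = -1 ∧ r₀ + ((n:ℝ) + 1)⁻¹ • x ∈ C}
  have key : ∀ (n : ℕ) (t : ℝ), 0 < t → t ≤ ((n:ℝ) + 1)⁻¹ → ∀ x, r₀ + ((n:ℝ) + 1)⁻¹ • x ∈ C →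
      r₀ + t • x ∈ C := by
    intro n t ht htn x hx
    have hn1 : (0:ℝ) < n + 1 := by positivity
    have h3 : t * (n + 1) ≤ 1 := by
      rw [← le_div_iff₀ hn1, one_div]; exact htn
    have := hC hr₀ hx (show 0 ≤ 1 - t * (n + 1) by linarith)
      (show 0 ≤ t * (n + 1) by positivity) (by ring)
    convert this using 1
    rw [smul_add, smul_smul, mul_assoc, mul_inv_cancel₀ hn1.ne', sub_smul, one_smul, mul_one]
    abel
  have hmono : Monotone X := by
    intro m n hmn x hx
    refine ⟨hx.1, key m _ (by positivity) ?_ x hx.2⟩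
    gcongr
  have htop : μH[2] (⋃ n, X n) = ⊤ := by
    refine top_le_iff.1 ?_
    rw [← wedge_top hl₁ hl₂ he₁ he₂ hne hne' hed he hu hu1 hu2]
    refine measure_mono fun x hx => ?_
    obtain ⟨n, hn⟩ := ray_mem hC hint hr₀ hcone hx.2.1 hx.2.2
    exact mem_iUnion.2 ⟨n, hx.1, hn⟩
  rw [hmono.measure_iUnion] at htop
  obtain ⟨n, hn⟩ := lt_iSup_iff.1 (htop ▸ hA)
  refine ⟨((n:ℝ) + 1)⁻¹, by positivity, fun t ht htn => ?_⟩
  calc ENNReal.ofReal (t ^ 2) * A ≤ ENNReal.ofReal (t ^ 2) * μH[2] (X n) := by gcongr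
    _ = μH[2] ((fun x => r₀ + x) '' ((fun x => t • x) '' X n)) := by
        rw [haus_vadd, haus_smul t ht]
    _ ≤ _ := by
        refine measure_mono ?_
        rintro _ ⟨_, ⟨x, hx, rfl⟩, rfl⟩
        refine ⟨key n t ht htn x hx.2, ?_⟩
        have : ⟪x, e⟫ = -1 := hx.1
        change ⟪r₀ + t • x - r₀, e⟫ = -t
        rw [add_sub_cancel_left, real_inner_smul_left, this]; ring

lemma exists_dual {e₁ e₂ u : E3} (he₁ : ‖e₁‖ = 1) (he₂ : ‖e₂‖ = 1) (hne : e₁ ≠ e₂)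
    (hne' : e₁ ≠ -e₂) (hu : ‖u‖ = 1) (hu1 : ⟪e₁, u⟫ = 0) (hu2 : ⟪e₂, u⟫ = 0) :
    ∃ k₁ k₂ : E3, ⟪k₁, e₁⟫ = 1 ∧ ⟪k₁, e₂⟫ = 0 ∧ ⟪k₂, e₁⟫ = 0 ∧ ⟪k₂, e₂⟫ = 1 ∧
      ⟪k₁, u⟫ = 0 ∧ ⟪k₂, u⟫ = 0 ∧
      (∀ x : E3, x = ⟪x, u⟫ • u + ⟪x, e₁⟫ • k₁ + ⟪x, e₂⟫ • k₂) ∧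
      (∀ x : E3, x = ⟪x, u⟫ • u + ⟪x, k₁⟫ • e₁ + ⟪x, k₂⟫ • e₂) := by
  obtain ⟨hg, hg2⟩ := inner_abs_lt he₁ he₂ hne hne'
  set g := ⟪e₁, e₂⟫ with hgdef
  have hg' : ⟪e₂, e₁⟫ = g := by rw [real_inner_comm]
  have h11 : ⟪e₁, e₁⟫ = 1 := by rw [real_inner_self_eq_norm_sq, he₁]; norm_num
  have h22 : ⟪e₂, e₂⟫ = 1 := by rw [real_inner_self_eq_norm_sq, he₂]; norm_num
  have huu : ⟪u, u⟫ = 1 := by rw [real_inner_self_eq_norm_sq, hu]; norm_num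
  have hu1' : ⟪u, e₁⟫ = 0 := by rw [real_inner_comm]; exact hu1
  have hu2' : ⟪u, e₂⟫ = 0 := by rw [real_inner_comm]; exact hu2
  have hd : 0 < 1 - g ^ 2 := by nlinarith
  set k₁ := (1 - g ^ 2)⁻¹ • (e₁ - g • e₂) with hk₁
  set k₂ := (1 - g ^ 2)⁻¹ • (e₂ - g • e₁) with hk₂
  have a1 : ⟪k₁, e₁⟫ = 1 := by
    rw [hk₁, real_inner_smul_left, inner_sub_left, real_inner_smul_left, h11, hg']
    field_simp
  have a2 : ⟪k₁, e₂⟫ = 0 := by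
    rw [hk₁, real_inner_smul_left, inner_sub_left, real_inner_smul_left, h22, ← hgdef]; ring
  have a3 : ⟪k₂, e₁⟫ = 0 := by
    rw [hk₂, real_inner_smul_left, inner_sub_left, real_inner_smul_left, h11, hg']; ring
  have a4 : ⟪k₂, e₂⟫ = 1 := by
    rw [hk₂, real_inner_smul_left, inner_sub_left, real_inner_smul_left, h22, ← hgdef]
    field_simp
  have a5 : ⟪k₁, u⟫ = 0 := by
    rw [hk₁, real_inner_smul_left, inner_sub_left, real_inner_smul_left, hu1, hu2]; ring
  have a6 : ⟪k₂, u⟫ = 0 := by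
    rw [hk₂, real_inner_smul_left, inner_sub_left, real_inner_smul_left, hu1, hu2]; ring
  let L : E3 →ₗ[ℝ] ℝ × ℝ × ℝ :=
    ((innerSL ℝ u).toLinearMap).prod
      (((innerSL ℝ e₁).toLinearMap).prod ((innerSL ℝ e₂).toLinearMap))
  have hLapp : ∀ x, L x = (⟪x, u⟫, ⟪x, e₁⟫, ⟪x, e₂⟫) := by
    intro x
    simp [L, real_inner_comm]
  have hLs : Function.Surjective L := by
    rintro ⟨a, b, c⟩
    refine ⟨a • u + b • k₁ + c • k₂, ?_⟩
    rw [hLapp]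
    simp only [inner_add_left, real_inner_smul_left, a1, a2, a3, a4, a5, a6, huu, hu1', hu2']
    simp
  have hLi : Function.Injective L :=
    (LinearMap.injective_iff_surjective_of_finrank_eq_finrank (by simp)).2 hLs
  have D1 : ∀ x : E3, x = ⟪x, u⟫ • u + ⟪x, e₁⟫ • k₁ + ⟪x, e₂⟫ • k₂ := by
    intro x
    apply hLi
    rw [hLapp, hLapp]
    simp only [inner_add_left, real_inner_smul_left, a1, a2, a3, a4, a5, a6, huu, hu1', hu2']
    simp
  refine ⟨k₁, k₂, a1, a2, a3, a4, a5, a6, D1, fun x => ?_⟩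
  set y := x - (⟪x, u⟫ • u + ⟪x, k₁⟫ • e₁ + ⟪x, k₂⟫ • e₂) with hy
  have y1 : ⟪y, u⟫ = 0 := by
    rw [hy, inner_sub_left, inner_add_left, inner_add_left, real_inner_smul_left,
      real_inner_smul_left, real_inner_smul_left, huu, hu1, hu2]; ring
  have y2 : ⟪y, k₁⟫ = 0 := by
    rw [hy, inner_sub_left, inner_add_left, inner_add_left, real_inner_smul_left,
      real_inner_smul_left, real_inner_smul_left, real_inner_comm k₁ u, a5, real_inner_comm k₁ e₁,
      a1, real_inner_comm k₁ e₂, a2]; ring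
  have y3 : ⟪y, k₂⟫ = 0 := by
    rw [hy, inner_sub_left, inner_add_left, inner_add_left, real_inner_smul_left,
      real_inner_smul_left, real_inner_smul_left, real_inner_comm k₂ u, a6, real_inner_comm k₂ e₁,
      a3, real_inner_comm k₂ e₂, a4]; ring
  have y0 : ⟪y, y⟫ = 0 := by
    have h := congrArg (fun z => ⟪y, z⟫) (D1 y)
    simp only [inner_add_right, real_inner_smul_right, y1, y2, y3, mul_zero, add_zero] at h
    exact h
  rw [inner_self_eq_zero] at y0
  exact sub_eq_zero.1 y0

lemma narrow {C : Set E3} {r₀ e e₁ e₂ u : E3}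
    {l₁ l₂ : ℝ} (hl₁ : 0 < l₁) (hl₂ : 0 < l₂)
    (he₁ : ‖e₁‖ = 1) (he₂ : ‖e₂‖ = 1) (hne : e₁ ≠ e₂) (hne' : e₁ ≠ -e₂)
    (hed : e = l₁ • e₁ + l₂ • e₂) (hu : ‖u‖ = 1) (hu1 : ⟪e₁, u⟫ = 0)
    (hu2 : ⟪e₂, u⟫ = 0)
    (h1 : ∀ x ∈ C, ⟪x - r₀, e₁⟫ ≤ 0) (h2 : ∀ x ∈ C, ⟪x - r₀, e₂⟫ ≤ 0) :
    ∃ M : ℝ, 0 < M ∧ ∀ t, 0 < t → ∀ r ∈ C, -t ≤ ⟪r - r₀, e⟫ →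
      ‖(r - r₀) - ⟪r - r₀, u⟫ • u‖ ≤ M * t := by
  obtain ⟨k₁, k₂, -, -, -, -, -, -, D1, -⟩ := exists_dual he₁ he₂ hne hne' hu hu1 hu2
  refine ⟨1 + ‖k₁‖ / l₁ + ‖k₂‖ / l₂, by positivity, fun t ht r hr hre => ?_⟩
  have A := h1 r hr
  have B := h2 r hr
  set x := r - r₀ with hx
  rw [hed, inner_add_right, real_inner_smul_right, real_inner_smul_right] at hre
  have A' : |⟪x, e₁⟫| ≤ t / l₁ := by
    rw [abs_of_nonpos A, le_div_iff₀ hl₁]; nlinarith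
  have B' : |⟪x, e₂⟫| ≤ t / l₂ := by
    rw [abs_of_nonpos B, le_div_iff₀ hl₂]; nlinarith
  have hxe : x - ⟪x, u⟫ • u = ⟪x, e₁⟫ • k₁ + ⟪x, e₂⟫ • k₂ := by
    have := D1 x
    rw [sub_eq_iff_eq_add]
    conv_lhs => rw [this]
    abel
  rw [hxe]
  calc ‖⟪x, e₁⟫ • k₁ + ⟪x, e₂⟫ • k₂‖ ≤ |⟪x, e₁⟫| * ‖k₁‖ + |⟪x, e₂⟫| * ‖k₂‖ := by
        refine (norm_add_le _ _).trans ?_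
        rw [norm_smul, norm_smul, Real.norm_eq_abs, Real.norm_eq_abs]
    _ ≤ t / l₁ * ‖k₁‖ + t / l₂ * ‖k₂‖ := by gcongr
    _ ≤ (1 + ‖k₁‖ / l₁ + ‖k₂‖ / l₂) * t := by
        have : (1 + ‖k₁‖ / l₁ + ‖k₂‖ / l₂) * t = t + (t / l₁ * ‖k₁‖ + t / l₂ * ‖k₂‖) := by ring
        linarith

lemma bad_bound {C : Set E3} (hcomp : IsCompact C) {r₀ e u : E3} (hu : ‖u‖ = 1) {M : ℝ}
    (hM : 0 < M) (hnar : ∀ t, 0 < t → ∀ r ∈ C, -t ≤ ⟪r - r₀, e⟫ →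
      ‖(r - r₀) - ⟪r - r₀, u⟫ • u‖ ≤ M * t) (ε : ℝ) (hε : 0 < ε) :
    ∃ A : ℝ≥0∞, A < ⊤ ∧ ∀ t, 0 < t →
      μH[2] {r | r ∈ Sset C r₀ e t ∧ IsRegularPt C r ∧ ε ≤ ⟪normalMap C r, u⟫} ≤
        ENNReal.ofReal (t ^ 2) * A := by
  have huu : ⟪u, u⟫ = 1 := by rw [real_inner_self_eq_norm_sq, hu]; norm_num
  let P : E3 → E3 := fun x => x - ⟪x, u⟫ • u
  have hPsub : ∀ x y, P x - P y = P (x - y) := by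
    intro x y; simp only [P, inner_sub_left, sub_smul]; abel
  let K : NNReal := ⟨1 + 1 / ε, by positivity⟩
  refine ⟨(K : ℝ≥0∞) ^ (2:ℝ) * (ENNReal.ofReal (M ^ 2) * μH[2] {x : E3 | ⟪x, u⟫ = 0 ∧ ‖x‖ ≤ 1}),
    ?_, ?_⟩
  · refine ENNReal.mul_lt_top ?_ (ENNReal.mul_lt_top ENNReal.ofReal_lt_top (disc_lt_top u hu 1))
    exact (ENNReal.rpow_ne_top_of_nonneg (by norm_num) ENNReal.coe_ne_top).lt_top
  intro t ht
  set Y := {r | r ∈ Sset C r₀ e t ∧ IsRegularPt C r ∧ ε ≤ ⟪normalMap C r, u⟫} with hY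
  have hYC : ∀ r ∈ Y, r ∈ C := fun r hr => hcomp.isClosed.frontier_subset hr.1.1
  have hhalf : ∀ r ∈ Y, ∀ r' ∈ Y, ⟪r' - r, u⟫ * ε ≤ ‖P (r' - r)‖ := by
    intro r hr r' hr'
    rcases le_or_gt ⟪r' - r, u⟫ 0 with h | h
    · exact (mul_nonpos_of_nonpos_of_nonneg h hε.le).trans (norm_nonneg _)
    have hn := normalMap_spec C r hr.2.1
    have h3 := hn.2 r' (hYC r' hr')
    have h4 : r' - r = P (r' - r) + ⟪r' - r, u⟫ • u := by simp [P]
    have h6 : ⟪r' - r, normalMap C r⟫ =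
        ⟪P (r' - r), normalMap C r⟫ + ⟪r' - r, u⟫ * ⟪u, normalMap C r⟫ := by
      conv_lhs => rw [h4]
      rw [inner_add_left, real_inner_smul_left]
    have h5 := abs_real_inner_le_norm (P (r' - r)) (normalMap C r)
    rw [hn.1, mul_one] at h5
    have h7 := (abs_le.1 h5).1
    have h8 : ε ≤ ⟪u, normalMap C r⟫ := by rw [real_inner_comm]; exact hr.2.2
    nlinarith
  have hanti : ∀ x ∈ Y, ∀ y ∈ Y, dist x y ≤ K * dist (P x) (P y) := by
    intro x hx y hy
    rw [dist_eq_norm, dist_eq_norm, hPsub]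
    have e1 := hhalf y hy x hx
    have e2 := hhalf x hx y hy
    have e3 : ‖P (y - x)‖ = ‖P (x - y)‖ := by
      rw [← hPsub, ← hPsub, norm_sub_rev]
    have e4 : ⟪y - x, u⟫ = -⟪x - y, u⟫ := by rw [← inner_neg_left, neg_sub]
    rw [e3, e4] at e2
    have e5 : |⟪x - y, u⟫| ≤ ‖P (x - y)‖ / ε := by
      rw [le_div_iff₀ hε]
      rcases abs_cases ⟪x - y, u⟫ with h | h <;> rw [h.1] <;> linarith
    have h4 : x - y = P (x - y) + ⟪x - y, u⟫ • u := by simp [P]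
    calc ‖x - y‖ = ‖P (x - y) + ⟪x - y, u⟫ • u‖ := by rw [← h4]
      _ ≤ ‖P (x - y)‖ + |⟪x - y, u⟫| := by
          refine (norm_add_le _ _).trans ?_
          rw [norm_smul, hu, mul_one, Real.norm_eq_abs]
      _ ≤ ‖P (x - y)‖ + ‖P (x - y)‖ / ε := by linarith
      _ = (1 + 1 / ε) * ‖P (x - y)‖ := by ring
  have himg : P '' Y ⊆ (fun x => P r₀ + x) '' {x : E3 | ⟪x, u⟫ = 0 ∧ ‖x‖ ≤ M * t} := by
    rintro _ ⟨r, hr, rfl⟩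
    refine ⟨P (r - r₀), ⟨?_, ?_⟩, ?_⟩
    · simp only [P]
      rw [inner_sub_left, real_inner_smul_left, huu]; ring
    · exact hnar t ht r (hYC r hr) hr.1.2
    · simp only [← hPsub]; abel
  calc μH[2] Y ≤ (K : ℝ≥0∞) ^ (2:ℝ) * μH[2] (P '' Y) := haus_antilip Y P K hanti
    _ ≤ (K : ℝ≥0∞) ^ (2:ℝ) * μH[2] {x : E3 | ⟪x, u⟫ = 0 ∧ ‖x‖ ≤ M * t} := by
        rw [← haus_vadd (P r₀) {x : E3 | ⟪x, u⟫ = 0 ∧ ‖x‖ ≤ M * t}]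
        gcongr
    _ = _ := by
        rw [disc_scale u (M * t) (by positivity), mul_pow, ENNReal.ofReal_mul (by positivity)]
        ring

lemma nu_bad {C : Set E3} (hcomp : IsCompact C) {r₀ e u : E3} (he : ‖e‖ = 1) (hu : ‖u‖ = 1) {M : ℝ}
    (hM : 0 < M) (hnar : ∀ t, 0 < t → ∀ r ∈ C, -t ≤ ⟪r - r₀, e⟫ →
      ‖(r - r₀) - ⟪r - r₀, u⟫ • u‖ ≤ M * t)
    (hgrow : ∀ A : ℝ≥0∞, A < ⊤ → ∃ t₀ : ℝ, 0 < t₀ ∧ ∀ t, 0 < t → t ≤ t₀ →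
      ENNReal.ofReal (t ^ 2) * A ≤ μH[2] (Bset C r₀ e t)) (ε : ℝ) (hε : 0 < ε) :
    Tendsto (fun t => nuT C r₀ e t {n | ε ≤ ⟪n, u⟫}) (𝓝[>] 0) (𝓝 0) := by
  obtain ⟨A, hA, hbd⟩ := bad_bound hcomp hu hM hnar ε hε
  rw [ENNReal.tendsto_nhds_zero]
  intro δ hδ
  rcases eq_or_ne δ ⊤ with rfl | hδt
  · exact Eventually.of_forall fun _ => le_top
  have hlt : A / δ + 1 < ⊤ := ENNReal.add_lt_top.2 ⟨ENNReal.div_lt_top hA.ne hδ.ne', by simp⟩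
  obtain ⟨t₀, ht₀, hg⟩ := hgrow _ hlt
  filter_upwards [Ioc_mem_nhdsGT ht₀] with t ht
  have hg' := hg t ht.1 ht.2
  have ht2 : 0 < ENNReal.ofReal (t ^ 2) := by
    rw [ENNReal.ofReal_pos]; exact pow_pos ht.1 2
  have hB0 : μH[2] (Bset C r₀ e t) ≠ 0 := by
    refine (lt_of_lt_of_le ?_ hg').ne'
    exact ENNReal.mul_pos ht2.ne' (by simp)
  have hBt := (B_lt_top hcomp he t : μH[2] (Bset C r₀ e t) < ⊤).ne
  rw [nuT_apply C hcomp r₀ e t _ (measurableSet_le (by fun_prop) (by fun_prop))]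
  have h3 : ENNReal.ofReal (t ^ 2) * A ≤ δ * μH[2] (Bset C r₀ e t) := by
    calc ENNReal.ofReal (t ^ 2) * A = δ * (ENNReal.ofReal (t ^ 2) * (A / δ)) := by
          rw [mul_left_comm, ENNReal.mul_div_cancel hδ.ne' hδt]
      _ ≤ δ * (ENNReal.ofReal (t ^ 2) * (A / δ + 1)) := by gcongr; exact le_self_add
      _ ≤ _ := by gcongr
  calc (μH[2] (Bset C r₀ e t))⁻¹ * _ ≤ (μH[2] (Bset C r₀ e t))⁻¹ * (δ * μH[2] (Bset C r₀ e t)) := by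
        gcongr
        exact (hbd t ht.1).trans h3
    _ = δ := by
        rw [mul_comm δ, ← mul_assoc, ENNReal.inv_mul_cancel hB0 hBt, one_mul]

lemma closed_limsup {ν : ℕ → Measure E3} {ν₀ : Measure E3} [∀ i, IsFiniteMeasure (ν i)]
    [IsFiniteMeasure ν₀]
    (h : ∀ f : BoundedContinuousFunction E3 ℝ,
      Tendsto (fun i => ∫ x, f x ∂(ν i)) atTop (𝓝 (∫ x, f x ∂ν₀)))
    {F : Set E3} (hF : IsClosed F) {c : ℝ≥0∞} (hc : ∀ᶠ i in atTop, c ≤ ν i F) : c ≤ ν₀ F := by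
  let μs : ℕ → FiniteMeasure E3 := fun i => ⟨ν i, inferInstance⟩
  let μ : FiniteMeasure E3 := ⟨ν₀, inferInstance⟩
  have ht : Tendsto μs atTop (𝓝 μ) := FiniteMeasure.tendsto_iff_forall_integral_tendsto.2 h
  have h1 := FiniteMeasure.limsup_measure_closed_le_of_tendsto ht hF
  refine le_trans ?_ h1
  exact le_limsup_of_frequently_le hc.frequently

lemma open_null {ν : ℕ → Measure E3} {ν₀ : Measure E3} [∀ i, IsFiniteMeasure (ν i)]
    [IsFiniteMeasure ν₀]
    (h : ∀ f : BoundedContinuousFunction E3 ℝ,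
      Tendsto (fun i => ∫ x, f x ∂(ν i)) atTop (𝓝 (∫ x, f x ∂ν₀)))
    {g : E3 → ℝ} (hg : Continuous g) (h0 : Tendsto (fun i => ν i {x | 0 < g x}) atTop (𝓝 0)) :
    ν₀ {x | 0 < g x} = 0 := by
  let f : BoundedContinuousFunction E3 ℝ :=
    BoundedContinuousFunction.ofNormedAddCommGroup (fun x => min 1 (max 0 (g x))) (by fun_prop) 1 (by
      intro x
      rw [Real.norm_eq_abs, abs_of_nonneg (by positivity)]
      exact min_le_left _ _)
  have hf : ∀ x, f x = min 1 (max 0 (g x)) := fun x => rfl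
  have hf0 : ∀ x, 0 ≤ f x := fun x => by rw [hf]; positivity
  have hms : MeasurableSet {x | 0 < g x} := measurableSet_lt (by fun_prop) (by fun_prop)
  have hle : ∀ i, ∫ x, f x ∂(ν i) ≤ (ν i {x | 0 < g x}).toReal := by
    intro i
    have : (ν i {x | 0 < g x}).toReal = ∫ x, indicator {x | 0 < g x} (fun _ => (1:ℝ)) x ∂(ν i) := by
      rw [integral_indicator hms]; simp [Measure.real]
    rw [this]
    refine integral_mono (f.integrable _) ((integrable_const _).indicator hms) fun x => ?_
    by_cases hx : 0 < g x
    · rw [indicator_of_mem (by exact hx), hf]; exact min_le_left _ _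
    · rw [indicator_of_notMem (by exact hx), hf, max_eq_left (not_lt.1 hx)]; simp
  have h1 : Tendsto (fun i => (ν i {x | 0 < g x}).toReal) atTop (𝓝 0) := by
    have := (ENNReal.tendsto_toReal ENNReal.zero_ne_top).comp h0
    rw [ENNReal.toReal_zero] at this
    exact this
  have h2 : ∫ x, f x ∂ν₀ ≤ 0 := le_of_tendsto_of_tendsto' (h f) h1 hle
  have h3 : ∫ x, f x ∂ν₀ = 0 := le_antisymm h2 (integral_nonneg hf0)
  rw [integral_eq_zero_iff_of_nonneg hf0 (f.integrable _)] at h3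
  have h4 : ∀ᵐ x ∂ν₀, ¬ (0 < g x) := by
    filter_upwards [h3] with x hx hgx
    have : f x = 0 := hx
    rw [hf] at this
    have h5 : 0 < min 1 (max 0 (g x)) := lt_min one_pos (lt_max_of_lt_right hgx)
    linarith
  rw [ae_iff] at h4
  simpa using h4

lemma limit_finite {ν : ℕ → Measure E3} {ν₀ : Measure E3} [∀ i, IsFiniteMeasure (ν i)]
    (h : ∀ f : BoundedContinuousFunction E3 ℝ,
      Tendsto (fun i => ∫ x, f x ∂(ν i)) atTop (𝓝 (∫ x, f x ∂ν₀)))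
    {c : ℝ≥0∞} (hc0 : 0 < c) (hc : ∀ i, c ≤ ν i univ) : IsFiniteMeasure ν₀ := by
  have h1 := h (BoundedContinuousFunction.const E3 1)
  simp only [BoundedContinuousFunction.const_apply, integral_const, smul_eq_mul, mul_one] at h1
  have hct : c ≠ ⊤ := ((hc 0).trans_lt (measure_lt_top _ _)).ne
  have h2 : c.toReal ≤ ν₀.real univ :=
    ge_of_tendsto' h1 fun i => ENNReal.toReal_mono (measure_ne_top _ _) (hc i)
  have h3 : 0 < c.toReal := ENNReal.toReal_pos hc0.ne' hct
  refine ⟨lt_top_iff_ne_top.2 fun htop => ?_⟩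
  rw [Measure.real, htop] at h2
  simp at h2
  linarith

lemma exists_limit {ν : ℕ → Measure E3} [∀ i, IsFiniteMeasure (ν i)] {K : NNReal}
    (hpos : ∀ i, ν i univ ≠ 0) (hK : ∀ i, ν i univ ≤ K)
    (hs : ∀ i, ν i (Metric.sphere 0 1)ᶜ = 0) :
    ∃ φ : ℕ → ℕ, StrictMono φ ∧ ∃ ν₀ : Measure E3, ∀ f : BoundedContinuousFunction E3 ℝ,
      Tendsto (fun i => ∫ x, f x ∂(ν (φ i))) atTop (𝓝 (∫ x, f x ∂ν₀)) := by
  let μs : ℕ → FiniteMeasure E3 := fun i => ⟨ν i, inferInstance⟩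
  have hne : ∀ i, μs i ≠ 0 := by
    intro i h0
    apply hpos i
    have : (μs i : Measure E3) univ = 0 := by rw [h0]; simp
    exact this
  have hcpt : IsCompact {μ : ProbabilityMeasure E3 | ∀ _ : ℕ, μ (Metric.sphere 0 1)ᶜ ≤ (0:NNReal)} :=
    isCompact_setOfPred_probabilityMeasure_mass_eq_compl_isCompact_le
      (u := fun _ => 0) (K := fun _ => Metric.sphere 0 1) tendsto_const_nhds
      (fun _ => isCompact_sphere _ _) (Or.inl inferInstance)
  have hmem : ∀ i, ((μs i).normalize, (μs i).mass) ∈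
      {μ : ProbabilityMeasure E3 | ∀ _ : ℕ, μ (Metric.sphere 0 1)ᶜ ≤ (0:NNReal)} ×ˢ Icc (0:NNReal) K := by
    intro i
    refine ⟨fun _ => ?_, by simp, ?_⟩
    · rw [(μs i).normalize_eq_of_nonzero (hne i)]
      have : (μs i) (Metric.sphere 0 1)ᶜ = 0 := by
        rw [FiniteMeasure.null_iff_toMeasure_null]; exact hs i
      rw [this, mul_zero]
    · have := hK i
      have h2 : ((μs i).mass : ℝ≥0∞) = ν i univ := (μs i).ennreal_mass
      rw [← h2] at this
      exact_mod_cast this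
  obtain ⟨⟨P, m⟩, -, φ, hφ, hlim⟩ := (hcpt.prod isCompact_Icc).isSeqCompact hmem
  refine ⟨φ, hφ, m • (P : Measure E3), fun f => ?_⟩
  have hP : Tendsto (fun i => (μs (φ i)).normalize) atTop (𝓝 P) :=
    (continuous_fst.tendsto _).comp hlim
  have hm : Tendsto (fun i => (μs (φ i)).mass) atTop (𝓝 m) :=
    (continuous_snd.tendsto _).comp hlim
  have h1 := ProbabilityMeasure.tendsto_iff_forall_integral_tendsto.1 hP f
  have h2 : Tendsto (fun i => ((μs (φ i)).mass : ℝ)) atTop (𝓝 (m : ℝ)) :=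
    (NNReal.continuous_coe.tendsto _).comp hm
  have h3 := h2.mul h1
  rw [integral_smul_nnreal_measure, NNReal.smul_def, smul_eq_mul]
  refine h3.congr fun i => ?_
  have h4 := (μs (φ i)).toMeasure_normalize_eq_of_nonzero (hne (φ i))
  rw [h4, integral_smul_nnreal_measure, NNReal.smul_def, smul_eq_mul, ← mul_assoc]
  have h5 : (μs (φ i)).mass ≠ 0 := (μs (φ i)).mass_nonzero_iff.2 (hne _)
  rw [NNReal.coe_inv, mul_inv_cancel₀ (by exact_mod_cast h5), one_mul]
  rfl

lemma nu_sphere {C : Set E3} (hcomp : IsCompact C) (r₀ e : E3) (t : ℝ) :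
    nuT C r₀ e t (Metric.sphere 0 1)ᶜ = 0 := by
  rw [nuT_apply C hcomp r₀ e t _ Metric.isClosed_sphere.measurableSet.compl]
  have : {r | r ∈ Sset C r₀ e t ∧ IsRegularPt C r ∧ normalMap C r ∈ (Metric.sphere (0:E3) 1)ᶜ} = ∅ := by
    refine Set.eq_empty_of_forall_notMem fun r hr => hr.2.2 ?_
    simpa using (normalMap_spec C r hr.2.1).1
  rw [this]; simp

lemma nu_upper {C : Set E3} (hcomp : IsCompact C) {r₀ e : E3} {t : ℝ} {K : NNReal}
    (hB : μH[2] (Bset C r₀ e t) ≠ 0) (hB' : μH[2] (Bset C r₀ e t) ≠ ⊤)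
    (hK : μH[2] (Sset C r₀ e t) ≤ K * μH[2] (Bset C r₀ e t)) :
    nuT C r₀ e t univ ≤ K := by
  rw [nuT_apply C hcomp r₀ e t _ MeasurableSet.univ]
  calc (μH[2] (Bset C r₀ e t))⁻¹ * _ ≤ (μH[2] (Bset C r₀ e t))⁻¹ * (K * μH[2] (Bset C r₀ e t)) := by
        gcongr
        exact (measure_mono fun r hr => hr.1).trans hK
    _ = K := by rw [mul_comm (K : ℝ≥0∞), ← mul_assoc, ENNReal.inv_mul_cancel hB hB', one_mul]

lemma nu_lower {C : Set E3} (hcomp : IsCompact C) {r₀ e v : E3} {t : ℝ} {c : ℝ≥0∞}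
    (hB : μH[2] (Bset C r₀ e t) ≠ 0) (hB' : μH[2] (Bset C r₀ e t) ≠ ⊤)
    (hc : c * μH[2] (Bset C r₀ e t) ≤
        μH[2] {r | r ∈ Sset C r₀ e t ∧ IsRegularPt C r ∧ ⟪normalMap C r, v⟫ ≤ 0}) :
    c ≤ nuT C r₀ e t {n | ⟪n, v⟫ ≤ 0} := by
  rw [nuT_apply C hcomp r₀ e t _ (measurableSet_le (by fun_prop) (by fun_prop))]
  calc c = (μH[2] (Bset C r₀ e t))⁻¹ * (c * μH[2] (Bset C r₀ e t)) := by
        rw [mul_comm c, ← mul_assoc, ENNReal.inv_mul_cancel hB hB', one_mul]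
    _ ≤ _ := by gcongr; exact hc

lemma nu_x {C : Set E3} (hcomp : IsCompact C) {r₀ e u x : E3} {M D t : ℝ}
    (hnar : ∀ t, 0 < t → ∀ r ∈ C, -t ≤ ⟪r - r₀, e⟫ →
      ‖(r - r₀) - ⟪r - r₀, u⟫ • u‖ ≤ M * t) (hD : ∀ r ∈ C, |⟪r - r₀, u⟫| ≤ D) (hx : x ∈ C)
    (ht : 0 < t) :
    nuT C r₀ e t {n | M * t < ⟪x - r₀, n⟫ - D * |⟪n, u⟫|} = 0 := by
  rw [nuT_apply C hcomp r₀ e t _ (measurableSet_lt (by fun_prop) (by fun_prop))]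
  have : {r | r ∈ Sset C r₀ e t ∧ IsRegularPt C r ∧ normalMap C r ∈
      {n | M * t < ⟪x - r₀, n⟫ - D * |⟪n, u⟫|}} = ∅ := by
    refine Set.eq_empty_of_forall_notMem fun r hr => ?_
    obtain ⟨⟨hrf, hre⟩, hreg, hlt⟩ := hr
    have hrC : r ∈ C := hcomp.isClosed.frontier_subset hrf
    have hn := normalMap_spec C r hreg
    set n := normalMap C r
    have hlt' : M * t < ⟪x - r₀, n⟫ - D * |⟪n, u⟫| := hlt
    have h3 := hn.2 x hx
    have h4 := hnar t ht r hrC hre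
    have h5 := hD r hrC
    have h6 : ⟪x - r₀, n⟫ = ⟪x - r, n⟫ + ⟪r - r₀, n⟫ := by
      rw [← inner_add_left]; congr 1; abel
    have h7 : ⟪r - r₀, n⟫ = ⟪(r - r₀) - ⟪r - r₀, u⟫ • u, n⟫ + ⟪r - r₀, u⟫ * ⟪n, u⟫ := by
      rw [inner_sub_left (𝕜 := ℝ) (r - r₀) (⟪r - r₀, u⟫ • u), real_inner_smul_left,
        real_inner_comm n u]; ring
    have h8 := abs_real_inner_le_norm ((r - r₀) - ⟪r - r₀, u⟫ • u) n
    rw [hn.1, mul_one] at h8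
    have h9 : ⟪r - r₀, u⟫ * ⟪n, u⟫ ≤ D * |⟪n, u⟫| := by
      refine (le_abs_self _).trans ?_
      rw [abs_mul]; gcongr
    have h10 := le_abs_self ⟪(r - r₀) - ⟪r - r₀, u⟫ • u, n⟫
    linarith
  rw [this]; simp

lemma arc_null {C : Set E3} {r₀ e₁ e₂ u k₁ k₂ : E3} {M D : ℝ}
    {ν : ℕ → Measure E3} {ν₀ : Measure E3} [∀ i, IsFiniteMeasure (ν i)] [IsFiniteMeasure ν₀]
    (h : ∀ f : BoundedContinuousFunction E3 ℝ,
      Tendsto (fun i => ∫ x, f x ∂(ν i)) atTop (𝓝 (∫ x, f x ∂ν₀)))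
    {ts : ℕ → ℝ} (hts : Tendsto ts atTop (𝓝 0))
    (hcone : tanCone C r₀ = dihedral e₁ e₂)
    (d11 : ⟪k₁, e₁⟫ = 1) (d12 : ⟪k₁, e₂⟫ = 0) (d21 : ⟪k₂, e₁⟫ = 0) (d22 : ⟪k₂, e₂⟫ = 1)
    (D2 : ∀ x : E3, x = ⟪x, u⟫ • u + ⟪x, k₁⟫ • e₁ + ⟪x, k₂⟫ • e₂)
    (hsph : ∀ i, ν i (Metric.sphere 0 1)ᶜ = 0)
    (hb1 : ∀ ε : ℝ, 0 < ε → Tendsto (fun i => ν i {n | ε ≤ ⟪n, u⟫}) atTop (𝓝 0))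
    (hb2 : ∀ ε : ℝ, 0 < ε → Tendsto (fun i => ν i {n | ε ≤ ⟪n, -u⟫}) atTop (𝓝 0))
    (hx : ∀ x ∈ C, ∀ i, ν i {n | M * ts i < ⟪x - r₀, n⟫ - D * |⟪n, u⟫|} = 0) :
    ν₀ (arcGamma e₁ e₂)ᶜ = 0 := by
  have A1 : ∀ᵐ n ∂ν₀, ‖n‖ = 1 := by
    have := open_null h (g := fun n => |‖n‖ - 1|) (by fun_prop) (by
      have h0 : ∀ i, ν i {n : E3 | 0 < |‖n‖ - 1|} = 0 := by
        intro i
        refine measure_mono_null ?_ (hsph i)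
        intro n hn hn'
        have hn2 : 0 < |‖n‖ - 1| := hn
        rw [mem_sphere_zero_iff_norm.1 hn'] at hn2
        simp at hn2
      simp only [h0]; exact tendsto_const_nhds)
    rw [ae_iff]
    refine measure_mono_null ?_ this
    intro n hn
    exact abs_pos.2 (sub_ne_zero.2 hn)
  have key : ∀ w : E3, (∀ ε : ℝ, 0 < ε → Tendsto (fun i => ν i {n | ε ≤ ⟪n, w⟫}) atTop (𝓝 0)) →
      ∀ᵐ n ∂ν₀, ⟪n, w⟫ ≤ 0 := by
    intro w hw
    have hk : ∀ k : ℕ, ∀ᵐ n ∂ν₀, ⟪n, w⟫ ≤ 1 / ((k:ℝ) + 1) := by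
      intro k
      have hkp : (0:ℝ) < 1 / ((k:ℝ) + 1) := by positivity
      have := open_null h (g := fun n => ⟪n, w⟫ - 1 / ((k:ℝ) + 1)) (by fun_prop) (by
        refine tendsto_of_tendsto_of_tendsto_of_le_of_le tendsto_const_nhds (hw _ hkp)
          (fun i => by simp) (fun i => measure_mono fun n hn => ?_)
        have hn2 : 0 < ⟪n, w⟫ - 1 / ((k:ℝ) + 1) := hn
        exact (sub_pos.1 hn2).le)
      rw [ae_iff]
      refine measure_mono_null ?_ this
      intro n hn
      exact sub_pos.2 (not_le.1 hn)
    filter_upwards [ae_all_iff.2 hk] with n hn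
    exact ge_of_tendsto' tendsto_one_div_add_atTop_nhds_zero_nat hn
  have A2 : ∀ᵐ n ∂ν₀, ⟪n, u⟫ = 0 := by
    filter_upwards [key u hb1, key (-u) hb2] with n h1 h2
    rw [inner_neg_right] at h2
    linarith
  have A3 : ∀ x ∈ C, ∀ᵐ n ∂ν₀, ⟪x - r₀, n⟫ ≤ 0 := by
    intro x hxC
    have hk : ∀ k : ℕ, ∀ᵐ n ∂ν₀, ⟪x - r₀, n⟫ - D * |⟪n, u⟫| ≤ 1 / ((k:ℝ) + 1) := by
      intro k
      have hkp : (0:ℝ) < 1 / ((k:ℝ) + 1) := by positivity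
      have := open_null h (g := fun n => ⟪x - r₀, n⟫ - D * |⟪n, u⟫| - 1 / ((k:ℝ) + 1))
        (by fun_prop) (by
        have hM : Tendsto (fun i => M * ts i) atTop (𝓝 0) := by
          simpa using hts.const_mul M
        refine tendsto_const_nhds.congr' ?_
        filter_upwards [hM.eventually (gt_mem_nhds hkp)] with i hi
        symm
        refine measure_mono_null ?_ (hx x hxC i)
        intro n hn
        have hn2 : 0 < ⟪x - r₀, n⟫ - D * |⟪n, u⟫| - 1 / ((k:ℝ) + 1) := hn
        change M * ts i < ⟪x - r₀, n⟫ - D * |⟪n, u⟫|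
        linarith)
      rw [ae_iff]
      refine measure_mono_null ?_ this
      intro n hn
      exact sub_pos.2 (not_le.1 hn)
    filter_upwards [ae_all_iff.2 hk, A2] with n hn hn2
    have := ge_of_tendsto' tendsto_one_div_add_atTop_nhds_zero_nat hn
    rw [hn2] at this
    simpa using this
  have A4 : ∀ y ∈ dihedral e₁ e₂, ∀ᵐ n ∂ν₀, ⟪y, n⟫ ≤ 0 := by
    intro y hy
    rw [← hcone, tanCone, mem_closure_iff_seq_limit] at hy
    obtain ⟨ys, hys, hlim⟩ := hy
    have hj : ∀ j, ∀ᵐ n ∂ν₀, ⟪ys j, n⟫ ≤ 0 := by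
      intro j
      obtain ⟨c, r, hr, hc, hyj⟩ := hys j
      filter_upwards [A3 r hr] with n hn
      rw [hyj, real_inner_smul_left]
      exact mul_nonpos_of_nonneg_of_nonpos hc hn
    filter_upwards [ae_all_iff.2 hj] with n hn
    exact le_of_tendsto' (hlim.inner tendsto_const_nhds) hn
  have B1 := A4 (-k₁) ⟨by rw [inner_neg_left, d11]; norm_num, by rw [inner_neg_left, d12]; norm_num⟩
  have B2 := A4 (-k₂) ⟨by rw [inner_neg_left, d21]; norm_num, by rw [inner_neg_left, d22]; norm_num⟩
  have : ∀ᵐ n ∂ν₀, n ∈ arcGamma e₁ e₂ := by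
    filter_upwards [A1, A2, B1, B2] with n h1 h2 h3 h4
    rw [inner_neg_left, real_inner_comm] at h3 h4
    refine ⟨⟪n, k₁⟫, ⟪n, k₂⟫, by linarith, by linarith, ?_, h1⟩
    have := D2 n
    rw [h2, zero_smul, zero_add] at this
    exact this
  exact this

lemma supp_e1 {e e₁ e₂ k₁ k₂ : E3} {l₁ l₂ : ℝ} (hl₁ : 0 < l₁) (hl₂ : 0 < l₂)
    (hed : e = l₁ • e₁ + l₂ • e₂) (he₁ : ‖e₁‖ = 1) (he₂ : ‖e₂‖ = 1)
    {ν : ℕ → Measure E3} {ν₀ : Measure E3} [∀ i, IsFiniteMeasure (ν i)] [IsFiniteMeasure ν₀]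
    (h : ∀ f : BoundedContinuousFunction E3 ℝ,
      Tendsto (fun i => ∫ x, f x ∂(ν i)) atTop (𝓝 (∫ x, f x ∂ν₀)))
    (d11 : ⟪k₁, e₁⟫ = 1) (d12 : ⟪k₁, e₂⟫ = 0) (d21 : ⟪k₂, e₁⟫ = 0) (d22 : ⟪k₂, e₂⟫ = 1)
    (hG : ν₀ (arcGamma e₁ e₂)ᶜ = 0)
    (hlow : ∀ (a₁ a₂ : ℝ) (v : E3), 0 < a₁ → 0 < a₂ → ⟪a₁ • e₁ + a₂ • e₂, v⟫ = 0 → ⟪e, v⟫ ≠ 0 →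
      ∃ c : ℝ≥0∞, 0 < c ∧ ∀ i, c ≤ ν i {n | ⟪n, v⟫ ≤ 0}) :
    e₁ ∈ msupport ν₀ := by
  intro U hU heU
  rw [pos_iff_ne_zero]
  intro hU0
  obtain ⟨ρ, hρ, hball⟩ := Metric.isOpen_iff.1 hU e₁ heU
  have c11 : ⟪e₁, k₁⟫ = 1 := by rw [real_inner_comm]; exact d11
  have c12 : ⟪e₂, k₁⟫ = 0 := by rw [real_inner_comm]; exact d12
  have c21 : ⟪e₁, k₂⟫ = 0 := by rw [real_inner_comm]; exact d21
  have c22 : ⟪e₂, k₂⟫ = 1 := by rw [real_inner_comm]; exact d22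
  obtain ⟨δ, hδ, hδ1, hδ2⟩ : ∃ δ : ℝ, 0 < δ ∧ δ * l₁ < l₂ ∧ δ * (2 * ‖k₁‖) < ρ := by
    refine ⟨min (l₂ / (2 * l₁)) (ρ / (2 * (2 * ‖k₁‖ + 1))), by positivity, ?_, ?_⟩
    · calc min (l₂ / (2 * l₁)) (ρ / (2 * (2 * ‖k₁‖ + 1))) * l₁ ≤ l₂ / (2 * l₁) * l₁ := by
            gcongr; exact min_le_left _ _
        _ = l₂ / 2 := by field_simp
        _ < l₂ := by linarith
    · calc min (l₂ / (2 * l₁)) (ρ / (2 * (2 * ‖k₁‖ + 1))) * (2 * ‖k₁‖)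
          ≤ ρ / (2 * (2 * ‖k₁‖ + 1)) * (2 * ‖k₁‖ + 1) := by
            gcongr
            · exact min_le_right _ _
            · linarith
        _ = ρ / 2 := by field_simp
        _ < ρ := by linarith
  set v := k₂ - δ • k₁ with hv
  have v1 : ⟪e₁, v⟫ = -δ := by rw [hv, inner_sub_right, real_inner_smul_right, c21, c11]; ring
  have v2 : ⟪e₂, v⟫ = 1 := by rw [hv, inner_sub_right, real_inner_smul_right, c22, c12]; ring
  obtain ⟨c, hc, hcl⟩ := hlow 1 δ v one_pos hδ
    (by rw [inner_add_left, real_inner_smul_left, real_inner_smul_left, v1, v2]; ring)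
    (by
      rw [hed, inner_add_left, real_inner_smul_left, real_inner_smul_left, v1, v2]
      intro h0
      linarith)
  have hcF : c ≤ ν₀ {n | ⟪n, v⟫ ≤ 0} :=
    closed_limsup h (isClosed_le (by fun_prop) (by fun_prop)) (Eventually.of_forall hcl)
  have hsub : {n | ⟪n, v⟫ ≤ 0} ⊆ (arcGamma e₁ e₂)ᶜ ∪ U := by
    intro n hn
    by_cases hnG : n ∈ arcGamma e₁ e₂
    · right
      apply hball
      obtain ⟨m₁, m₂, hm₁, hm₂, hne, hn1⟩ := hnG
      have hnv : m₂ ≤ δ * m₁ := by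
        have : ⟪n, v⟫ ≤ 0 := hn
        rw [hne, inner_add_left, real_inner_smul_left, real_inner_smul_left, v1, v2] at this
        linarith
      have hmk : m₁ ≤ ‖k₁‖ := by
        have h3 : ⟪n, k₁⟫ = m₁ := by
          rw [hne, inner_add_left, real_inner_smul_left, real_inner_smul_left, c11, c12]; ring
        have h4 := real_inner_le_norm n k₁
        rwa [h3, hn1, one_mul] at h4
      have hm1 : |m₁ - 1| ≤ m₂ := by
        have h5 := abs_norm_sub_norm_le (m₁ • e₁) n
        have h6 : m₁ • e₁ - n = -(m₂ • e₂) := by rw [hne]; abel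
        rw [h6, norm_neg, norm_smul, norm_smul, he₁, he₂, hn1, Real.norm_eq_abs, Real.norm_eq_abs,
          abs_of_nonneg hm₁, abs_of_nonneg hm₂, mul_one, mul_one] at h5
        exact h5
      rw [Metric.mem_ball, dist_eq_norm]
      have h7 : n - e₁ = (m₁ - 1) • e₁ + m₂ • e₂ := by rw [hne, sub_smul, one_smul]; abel
      calc ‖n - e₁‖ ≤ |m₁ - 1| + m₂ := by
            rw [h7]
            refine (norm_add_le _ _).trans ?_
            rw [norm_smul, norm_smul, he₁, he₂, Real.norm_eq_abs, Real.norm_eq_abs,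
              abs_of_nonneg hm₂, mul_one, mul_one]
        _ ≤ 2 * (δ * ‖k₁‖) := by
            have := mul_le_mul_of_nonneg_left hmk hδ.le
            linarith
        _ < ρ := by linarith
    · left; exact hnG
  have h0 : ν₀ {n | ⟪n, v⟫ ≤ 0} = 0 :=
    measure_mono_null hsub (measure_union_null hG hU0)
  rw [h0] at hcF
  exact absurd hc (not_lt.2 hcF)

lemma arcGamma_comm (e₁ e₂ : E3) : arcGamma e₁ e₂ = arcGamma e₂ e₁ := by
  ext v
  constructor
  · rintro ⟨a, b, ha, hb, h1, h2⟩
    exact ⟨b, a, hb, ha, by rw [h1, add_comm], h2⟩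
  · rintro ⟨a, b, ha, hb, h1, h2⟩
    exact ⟨b, a, hb, ha, by rw [h1, add_comm], h2⟩

/-- **Theorem 2 (paper Thm 1.2).** The set of partial weak limits of `ν_t` as `t → 0⁺` is
nonempty, and each partial limit is supported on a closed subset of the arc `Γ`
containing `e₁` and `e₂`. -/
theorem partial_weak_limits_nonempty_and_supported_on_arc
    (C : Set E3) (r₀ e₁ e₂ e : E3) (lam₁ lam₂ : ℝ)
    (hC : IsConvexBody C) (hr₀ : r₀ ∈ frontier C)
    (he₁ : ‖e₁‖ = 1) (he₂ : ‖e₂‖ = 1) (hne : e₁ ≠ e₂) (hne' : e₁ ≠ -e₂)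
    (hcone : tanCone C r₀ = dihedral e₁ e₂)
    (hl₁ : 0 < lam₁) (hl₂ : 0 < lam₂) (he : e = lam₁ • e₁ + lam₂ • e₂) (hnorm : ‖e‖ = 1) :
    (∃ ν₀ : Measure E3, IsPartialWeakLimit (nuT C r₀ e) ν₀) ∧
    ∀ ν₀ : Measure E3, IsPartialWeakLimit (nuT C r₀ e) ν₀ →
      ν₀ (arcGamma e₁ e₂)ᶜ = 0 ∧ e₁ ∈ msupport ν₀ ∧ e₂ ∈ msupport ν₀ := by
  obtain ⟨hcomp, hconv, p, hp⟩ := hC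
  have hint : (interior C).Nonempty := ⟨p, hp⟩
  have hr₀C : r₀ ∈ C := hcomp.isClosed.frontier_subset hr₀
  have hdih : ∀ x ∈ C, x - r₀ ∈ dihedral e₁ e₂ := by
    intro x hx
    rw [← hcone]
    exact subset_closure ⟨1, x, hx, zero_le_one, by rw [one_smul]⟩
  have h1 : ∀ x ∈ C, ⟪x - r₀, e₁⟫ ≤ 0 := fun x hx => (hdih x hx).1
  have h2 : ∀ x ∈ C, ⟪x - r₀, e₂⟫ ≤ 0 := fun x hx => (hdih x hx).2
  have hee : ∀ x ∈ C, ⟪x - r₀, e⟫ ≤ 0 := by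
    intro x hx
    rw [he, inner_add_right, real_inner_smul_right, real_inner_smul_right]
    have a := mul_nonpos_of_nonneg_of_nonpos hl₁.le (h1 x hx)
    have b := mul_nonpos_of_nonneg_of_nonpos hl₂.le (h2 x hx)
    linarith
  have hh : 0 < ⟪r₀ - p, e⟫ := by
    obtain ⟨ρ, hρ, hb⟩ := Metric.isOpen_iff.1 isOpen_interior p hp
    have hmem : p + (ρ / 2) • e ∈ C := by
      apply interior_subset
      apply hb
      rw [Metric.mem_ball, dist_eq_norm, add_sub_cancel_left, norm_smul, hnorm, mul_one,
        Real.norm_eq_abs, abs_of_pos (by positivity)]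
      linarith
    have h3 := hee _ hmem
    have h4 : p + (ρ / 2) • e - r₀ = (ρ / 2) • e - (r₀ - p) := by abel
    rw [h4, inner_sub_left (𝕜 := ℝ) ((ρ / 2) • e), real_inner_smul_left,
      real_inner_self_eq_norm_sq, hnorm] at h3
    linarith
  obtain ⟨u, hu, hu1, hu2⟩ := exists_u e₁ e₂
  obtain ⟨k₁, k₂, d11, d12, d21, d22, -, -, D1, D2⟩ := exists_dual he₁ he₂ hne hne' hu hu1 hu2
  obtain ⟨M, hM, hnar⟩ := narrow (C := C) (r₀ := r₀) hl₁ hl₂ he₁ he₂ hne hne' he hu hu1 hu2 h1 h2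
  have hgrow := B_growth hconv hint hr₀C hl₁ hl₂ he₁ he₂ hne hne' he hnorm hu hu1 hu2 hcone
  obtain ⟨D, hD⟩ : ∃ D : ℝ, ∀ r ∈ C, |⟪r - r₀, u⟫| ≤ D := by
    obtain ⟨R, hR⟩ := hcomp.isBounded.exists_norm_le
    refine ⟨R + ‖r₀‖, fun r hr => ?_⟩
    have h3 := abs_real_inner_le_norm (r - r₀) u
    rw [hu, mul_one] at h3
    exact h3.trans ((norm_sub_le _ _).trans (by linarith [hR r hr]))
  have hnar' : ∀ t, 0 < t → ∀ r ∈ C, -t ≤ ⟪r - r₀, e⟫ →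
      ‖(r - r₀) - ⟪r - r₀, -u⟫ • (-u)‖ ≤ M * t := by
    intro t ht r hr hre
    have := hnar t ht r hr hre
    rwa [inner_neg_right, smul_neg, neg_smul, neg_neg]
  have hbad1 := nu_bad hcomp hnorm hu hM hnar hgrow
  have hbad2 := nu_bad hcomp hnorm (by rwa [norm_neg] : ‖-u‖ = 1) hM hnar' hgrow
  obtain ⟨K, hK⟩ := S_upper hconv hcomp hnorm hp hh
  obtain ⟨t₀, ht₀, hg1⟩ := hgrow 1 (by simp)
  set tm := min t₀ (⟪r₀ - p, e⟫ / 2) with htm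
  have htm0 : 0 < tm := lt_min ht₀ (by linarith)
  have hBt : ∀ t, μH[2] (Bset C r₀ e t) ≠ ⊤ := fun t => (B_lt_top hcomp hnorm t).ne
  have hB0 : ∀ t, 0 < t → t ≤ tm → μH[2] (Bset C r₀ e t) ≠ 0 := by
    intro t ht ht'
    refine (lt_of_lt_of_le ?_ (hg1 t ht (ht'.trans (min_le_left _ _)))).ne'
    rw [mul_one, ENNReal.ofReal_pos]
    positivity
  have hup : ∀ t, 0 < t → t ≤ tm → nuT C r₀ e t univ ≤ K := fun t ht ht' =>
    nu_upper hcomp (hB0 t ht ht') (hBt t) (hK t (ht'.trans (min_le_right _ _)))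
  have hlow : ∀ (a₁ a₂ : ℝ) (v : E3), 0 < a₁ → 0 < a₂ → ⟪a₁ • e₁ + a₂ • e₂, v⟫ = 0 → ⟪e, v⟫ ≠ 0 →
      ∃ c : ℝ≥0∞, 0 < c ∧ ∀ t, 0 < t → t ≤ tm → c ≤ nuT C r₀ e t {n | ⟪n, v⟫ ≤ 0} := by
    intro a₁ a₂ v ha₁ ha₂ hv hev
    obtain ⟨c, hc, -, hcl⟩ := back_lower hconv hcomp hl₁ hl₂ ha₁ ha₂ he hnorm hp hh hr₀C h1 h2 hv hev
    exact ⟨c, hc, fun t ht ht' => nu_lower hcomp (hB0 t ht ht') (hBt t)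
      (hcl t ht (ht'.trans (min_le_right _ _)))⟩
  obtain ⟨c, hc0, hmass⟩ : ∃ c : ℝ≥0∞, 0 < c ∧ ∀ t, 0 < t → t ≤ tm → c ≤ nuT C r₀ e t univ := by
    have c11 : ⟪e₁, k₁⟫ = 1 := by rw [real_inner_comm]; exact d11
    have c12 : ⟪e₂, k₁⟫ = 0 := by rw [real_inner_comm]; exact d12
    have c21 : ⟪e₁, k₂⟫ = 0 := by rw [real_inner_comm]; exact d21
    have c22 : ⟪e₂, k₂⟫ = 1 := by rw [real_inner_comm]; exact d22
    set δ := lam₂ / (2 * lam₁) with hδ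
    have v1 : ⟪e₁, k₂ - δ • k₁⟫ = -δ := by
      rw [inner_sub_right, real_inner_smul_right, c21, c11]; ring
    have v2 : ⟪e₂, k₂ - δ • k₁⟫ = 1 := by
      rw [inner_sub_right, real_inner_smul_right, c22, c12]; ring
    obtain ⟨c, hc, hcl⟩ := hlow 1 δ (k₂ - δ • k₁) one_pos (by positivity)
      (by rw [inner_add_left, real_inner_smul_left, real_inner_smul_left, v1, v2]; ring)
      (by
        rw [he, inner_add_left, real_inner_smul_left, real_inner_smul_left, v1, v2]
        have : lam₁ * δ = lam₂ / 2 := by rw [hδ]; field_simp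
        intro h0
        linarith)
    exact ⟨c, hc, fun t ht ht' => (hcl t ht ht').trans (measure_mono (subset_univ _))⟩
  constructor
  · let ts : ℕ → ℝ := fun i => tm * (1 / ((i:ℝ) + 1))
    have hts0 : ∀ i, 0 < ts i := fun i => by positivity
    have hts1 : ∀ i, ts i ≤ tm := fun i => by
      refine mul_le_of_le_one_right htm0.le ?_
      rw [div_le_one (by positivity)]
      have : (0:ℝ) ≤ i := Nat.cast_nonneg i
      linarith
    have htsl : Tendsto ts atTop (𝓝 0) := by
      have h3 := (tendsto_one_div_add_atTop_nhds_zero_nat (𝕜 := ℝ)).const_mul tm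
      rw [mul_zero] at h3
      exact h3
    haveI : ∀ i, IsFiniteMeasure (nuT C r₀ e (ts i)) := fun i =>
      ⟨(hup _ (hts0 i) (hts1 i)).trans_lt ENNReal.coe_lt_top⟩
    obtain ⟨φ, hφ, ν₀, hν₀⟩ := exists_limit (ν := fun i => nuT C r₀ e (ts i)) (K := K)
      (fun i => (hc0.trans_le (hmass _ (hts0 i) (hts1 i))).ne')
      (fun i => hup _ (hts0 i) (hts1 i)) (fun i => nu_sphere hcomp r₀ e _)
    exact ⟨ν₀, fun i => ts (φ i), fun i => hts0 _, htsl.comp hφ.tendsto_atTop, hν₀⟩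
  · rintro ν₀ ⟨ts', hts0', htsl', hlim'⟩
    obtain ⟨N, hN⟩ := eventually_atTop.1 (htsl'.eventually (ge_mem_nhds htm0))
    let ts : ℕ → ℝ := fun i => ts' (i + N)
    have hts0 : ∀ i, 0 < ts i := fun i => hts0' _
    have hts1 : ∀ i, ts i ≤ tm := fun i => hN _ (by omega)
    have htsl : Tendsto ts atTop (𝓝 0) := htsl'.comp (tendsto_add_atTop_nat N)
    have hlim : ∀ f : BoundedContinuousFunction E3 ℝ,
        Tendsto (fun i => ∫ x, f x ∂(nuT C r₀ e (ts i))) atTop (𝓝 (∫ x, f x ∂ν₀)) :=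
      fun f => (hlim' f).comp (tendsto_add_atTop_nat N)
    haveI : ∀ i, IsFiniteMeasure (nuT C r₀ e (ts i)) := fun i =>
      ⟨(hup _ (hts0 i) (hts1 i)).trans_lt ENNReal.coe_lt_top⟩
    haveI : IsFiniteMeasure ν₀ := limit_finite (ν := fun i => nuT C r₀ e (ts i)) hlim hc0
      (fun i => hmass _ (hts0 i) (hts1 i))
    have htsr : Tendsto ts atTop (𝓝[>] 0) :=
      tendsto_nhdsWithin_iff.2 ⟨htsl, Eventually.of_forall hts0⟩
    have hG : ν₀ (arcGamma e₁ e₂)ᶜ = 0 :=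
      arc_null (ν := fun i => nuT C r₀ e (ts i)) hlim htsl hcone d11 d12 d21 d22 D2
        (fun i => nu_sphere hcomp r₀ e _)
        (fun ε hε => (hbad1 ε hε).comp htsr) (fun ε hε => (hbad2 ε hε).comp htsr)
        (fun x hx i => nu_x hcomp hnar hD hx (hts0 i))
    have hlow1 : ∀ (a₁ a₂ : ℝ) (v : E3), 0 < a₁ → 0 < a₂ → ⟪a₁ • e₁ + a₂ • e₂, v⟫ = 0 →
        ⟪e, v⟫ ≠ 0 → ∃ c : ℝ≥0∞, 0 < c ∧ ∀ i, c ≤ nuT C r₀ e (ts i) {n | ⟪n, v⟫ ≤ 0} := by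
      intro a₁ a₂ v ha₁ ha₂ hv hev
      obtain ⟨c, hc, hcl⟩ := hlow a₁ a₂ v ha₁ ha₂ hv hev
      exact ⟨c, hc, fun i => hcl _ (hts0 i) (hts1 i)⟩
    refine ⟨hG, ?_, ?_⟩
    · exact supp_e1 (ν := fun i => nuT C r₀ e (ts i)) hl₁ hl₂ he he₁ he₂ hlim d11 d12 d21 d22 hG hlow1
    · refine supp_e1 (e := e) (ν := fun i => nuT C r₀ e (ts i)) hl₂ hl₁ (by rw [he, add_comm]) he₂ he₁ hlim
        d22 d21 d12 d11 (by rwa [arcGamma_comm]) ?_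
      intro a₁ a₂ v ha₁ ha₂ hv hev
      exact hlow1 a₂ a₁ v ha₂ ha₁ (by rwa [add_comm]) hev
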